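/- arXiv:2206.05243 — 2 statements merged into one kernel-verified Lean document; each statement's English description precedes it below -/
import Mathlib

section
/- Ground space traversal (Theorem 1.4 / thm:traversal): There exists a universal constant C > 0 such that the following holds. Let n ≥ 1, d = 2^n, and let H be a d×d Hermitian matrix with 0 ≼ H ≼ I. Let ψ, φ ∈ ℂ^d be unit vectors with ⟨ψ, Hψ⟩ ≤ η and ⟨φ, Hφ⟩ ≤ η for some η ≥ 0. Then for every Δ with 0 < Δ ≤ 1 there exist m ∈ ℕ with m ≤ (C·n²·d²/Δ)^(2n) and 2-local unitaries U_1, …, U_m on (ℂ²)^{⊗n} such that (1) ‖U_m⋯U_1 ψ − φ‖ ≤ Δ, and (2) for every i ∈ {1,…,m}, ⟨ψ_i, H ψ_i⟩ ≤ η + Δ, where ψ_i := U_i⋯U_1 ψ. -/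
open scoped ComplexOrder Matrix Matrix.Norms.L2Operator

/-- Euclidean norm of a complex vector. -/
noncomputable def enorm {I : Type*} [Fintype I] (u : I → ℂ) : ℝ :=
  Real.sqrt (∑ i, ‖u i‖ ^ 2)

/-- Standard Hermitian inner product, conjugate-linear in the first argument. -/
noncomputable def ip {I : Type*} [Fintype I] (u v : I → ℂ) : ℂ :=
  ∑ i, (starRingEnd ℂ) (u i) * v i

/-- A unitary on `n` qubits is 2-local if it acts as a unitary `V` on two qubits `i, j`
and as the identity elsewhere. -/
def IsTwoLocalUnitary {n : ℕ} (U : Matrix (Fin n → Fin 2) (Fin n → Fin 2) ℂ) : Prop :=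
  Uᴴ * U = 1 ∧ U * Uᴴ = 1 ∧
  ∃ (i j : Fin n) (V : Matrix (Fin 2 × Fin 2) (Fin 2 × Fin 2) ℂ),
    Vᴴ * V = 1 ∧ V * Vᴴ = 1 ∧
    ∀ x y : Fin n → Fin 2,
      U x y = if ∀ k, k ≠ i → k ≠ j → x k = y k then V (x i, x j) (y i, y j) else 0

/-- `seqApply U ψ k = U_{k-1} ⋯ U_1 U_0 ψ` (0-based indexing of the gates). -/
noncomputable def seqApply {I : Type*} [Fintype I] (U : ℕ → Matrix I I ℂ) (ψ : I → ℂ) :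
    ℕ → (I → ℂ)
  | 0 => ψ
  | (k + 1) => (U k).mulVec (seqApply U ψ k)


namespace GST
open Complex

abbrev Mt (n : ℕ) := Matrix (Fin n → Fin 2) (Fin n → Fin 2) ℂ

def Uni {n : ℕ} (U : Mt n) : Prop := Uᴴ * U = 1 ∧ U * Uᴴ = 1

lemma Uni.norm_le {n : ℕ} {U : Mt n} (h : Uni U) : ‖U‖ ≤ 1 := by
  have : U ∈ unitary (Mt n) := ⟨h.1, h.2⟩
  exact (CStarRing.norm_of_mem_unitary this).le

lemma Uni.mul {n : ℕ} {U V : Mt n} (h : Uni U) (k : Uni V) : Uni (U * V) := by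
  have h1 : U ∈ unitary (Mt n) := ⟨h.1, h.2⟩
  have h2 : V ∈ unitary (Mt n) := ⟨k.1, k.2⟩
  have := mul_mem h1 h2
  exact ⟨this.1, this.2⟩

lemma uni_one {n : ℕ} : Uni (1 : Mt n) := by simp [Uni]

def LocInv {n : ℕ} (A : Mt n) : Prop :=
  Aᴴ = A ∧ A * A = 1 ∧
  ∃ (i j : Fin n) (V : Matrix (Fin 2 × Fin 2) (Fin 2 × Fin 2) ℂ),
    Vᴴ = V ∧ V * V = 1 ∧
    ∀ x y : Fin n → Fin 2,
      A x y = if ∀ k, k ≠ i → k ≠ j → x k = y k then V (x i, x j) (y i, y j) else 0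

/-- rotation -/
noncomputable def rot {I : Type*} [DecidableEq I] (A : Matrix I I ℂ) (t : ℝ) : Matrix I I ℂ :=
  (Real.cos t : ℂ) • (1 : Matrix I I ℂ) + (Complex.I * (Real.sin t : ℂ)) • A

lemma rot_star {I : Type*} [DecidableEq I] (A : Matrix I I ℂ) (hA : Aᴴ = A) (t : ℝ) :
    (rot A t)ᴴ = rot A (-t) := by
  simp [rot, Matrix.conjTranspose_add, Matrix.conjTranspose_smul, hA, ← Complex.ofReal_sin,
    ← Complex.ofReal_cos, -Complex.ofReal_sin, -Complex.ofReal_cos, Complex.conj_ofReal]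

lemma rot_mul {I : Type*} [Fintype I] [DecidableEq I] (A : Matrix I I ℂ) (hA : A * A = 1)
    (s t : ℝ) : rot A s * rot A t = rot A (s + t) := by
  simp only [rot, add_mul, mul_add, smul_mul_assoc, mul_smul_comm, one_mul, mul_one, hA,
    Real.cos_add, Real.sin_add, smul_smul]
  push_cast
  have : Complex.I * Complex.I = -1 := Complex.I_mul_I
  match_scalars
  · linear_combination (Complex.sin s * Complex.sin t) * this
  · ring

lemma rot_zero {I : Type*} [DecidableEq I] (A : Matrix I I ℂ) : rot A 0 = 1 := by
  simp [rot]

lemma rot_uni {I : Type*} [Fintype I] [DecidableEq I] (A : Matrix I I ℂ) (hA : Aᴴ = A)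
    (hA2 : A * A = 1) (t : ℝ) :
    (rot A t)ᴴ * rot A t = 1 ∧ rot A t * (rot A t)ᴴ = 1 := by
  rw [rot_star A hA, rot_mul A hA2, rot_mul A hA2]; simp [rot_zero]

lemma agree_iff {n : ℕ} (i j : Fin n) (x y : Fin n → Fin 2) :
    x = y ↔ (∀ k, k ≠ i → k ≠ j → x k = y k) ∧ ((x i, x j) = (y i, y j)) := by
  constructor
  · rintro rfl; simp
  · rintro ⟨h1, h2⟩
    rw [Prod.mk.injEq] at h2
    funext k
    by_cases hi : k = i
    · subst hi; exact h2.1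
    by_cases hj : k = j
    · subst hj; exact h2.2
    exact h1 k hi hj

lemma LocInv.rot {n : ℕ} {A : Mt n} (h : LocInv A) (t : ℝ) : IsTwoLocalUnitary (rot A t) := by
  obtain ⟨h1, h2, i, j, V, hV1, hV2, hV⟩ := h
  refine ⟨(rot_uni A h1 h2 t).1, (rot_uni A h1 h2 t).2, i, j, GST.rot V t,
    (rot_uni V hV1 hV2 t).1, (rot_uni V hV1 hV2 t).2, ?_⟩
  intro x y
  simp only [GST.rot, Matrix.add_apply, Matrix.smul_apply, hV, Matrix.one_apply]
  have hxy := agree_iff i j x y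
  by_cases hc : ∀ k, k ≠ i → k ≠ j → x k = y k
  · have e : (x = y) = ((x i, x j) = (y i, y j)) := propext ⟨fun h => (hxy.1 h).2, fun h => hxy.2 ⟨hc, h⟩⟩
    rw [if_pos hc, if_pos hc]
    simp only [e]
  · rw [if_neg hc, if_neg hc, if_neg (fun h => hc (hxy.1 h).1)]; simp

lemma LocInv.uni {n : ℕ} {A : Mt n} (h : LocInv A) : Uni A := by
  obtain ⟨h1, h2, -⟩ := h
  exact ⟨by rw [h1, h2], by rw [h1, h2]⟩

lemma phase_local {n : ℕ} (hn : 1 ≤ n) (u : ℂ) (hu : ‖u‖ = 1) :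
    IsTwoLocalUnitary (u • (1 : Mt n)) := by
  have h1 : star u * u = 1 := by
    have := Complex.conj_mul' u
    rw [hu] at this; simpa using this
  have h2 : u * star u = 1 := by rw [mul_comm]; exact h1
  refine ⟨by simp [Matrix.conjTranspose_smul, smul_smul, h1, h2, -Complex.star_def, -RCLike.star_def],
    by simp [Matrix.conjTranspose_smul, smul_smul, h1, h2, -Complex.star_def, -RCLike.star_def], ⟨0, hn⟩, ⟨0, hn⟩,
    u • 1, by simp [Matrix.conjTranspose_smul, smul_smul, h1, h2, -Complex.star_def, -RCLike.star_def],
    by simp [Matrix.conjTranspose_smul, smul_smul, h1, h2, -Complex.star_def, -RCLike.star_def], ?_⟩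
  intro x y
  simp only [Matrix.smul_apply, Matrix.one_apply]
  have hxy := agree_iff ⟨0, hn⟩ ⟨0, hn⟩ x y
  by_cases hc : ∀ k, k ≠ (⟨0, hn⟩ : Fin n) → k ≠ (⟨0, hn⟩ : Fin n) → x k = y k
  · have e : (x = y) = ((x ⟨0, hn⟩, x ⟨0, hn⟩) = (y ⟨0, hn⟩, y ⟨0, hn⟩)) :=
      propext ⟨fun h => (hxy.1 h).2, fun h => hxy.2 ⟨hc, h⟩⟩
    rw [if_pos hc]
    simp only [e]
  · rw [if_neg hc, if_neg (fun h => hc (hxy.1 h).1)]; simp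

lemma sin_err (t : ℝ) : |Real.sin t - t| ≤ 3 * t ^ 2 := by
  by_cases h : |t| ≤ 1
  · have := Real.sin_bound h
    have h0 := abs_nonneg t
    have h3 : |t| ^ 5 ≤ t ^ 2 := by
      rw [← sq_abs t]; nlinarith [pow_le_one₀ (n := 3) h0 h, sq_nonneg (|t|)]
    have h4 : |t ^ 3| ≤ t ^ 2 := by
      rw [abs_pow, ← sq_abs t]; nlinarith [sq_nonneg (|t|)]
    rw [abs_le] at *
    constructor <;> nlinarith
  · push Not at h
    have h1 := Real.abs_sin_le_one t
    have : |Real.sin t - t| ≤ |Real.sin t| + |t| := abs_sub _ _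
    nlinarith [sq_abs t]

lemma cos_err (t : ℝ) : |Real.cos t - 1| ≤ t ^ 2 / 2 := by
  have := Real.one_sub_sq_div_two_le_cos (x := t)
  rw [abs_le]; constructor <;> nlinarith [Real.cos_le_one t]

lemma cos_err1 (t : ℝ) : |Real.cos t - 1| ≤ |t| := by
  by_cases h : |t| ≤ 2
  · have := cos_err t
    nlinarith [sq_abs t, abs_nonneg t]
  · push Not at h
    rw [abs_le]; constructor <;> nlinarith [Real.cos_le_one t, Real.neg_one_le_cos t]

lemma rot_dev {n : ℕ} {A : Mt n} (h : LocInv A) (t : ℝ) : ‖rot A t - 1‖ ≤ 2 * |t| := by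
  have e : rot A t - 1 = ((Real.cos t - 1 : ℝ) : ℂ) • (1 : Mt n) + (Complex.I * (Real.sin t : ℂ)) • A := by
    simp only [rot]; push_cast; module
  rw [e]
  refine (norm_add_le _ _).trans ?_
  rw [norm_smul, norm_smul, norm_mul, Complex.norm_I, Complex.norm_real, Complex.norm_real,
    Real.norm_eq_abs, Real.norm_eq_abs]
  have h1 := uni_one (n := n).norm_le
  have h2 := h.uni.norm_le
  have h3 := cos_err1 t
  have h4 : |Real.sin t| ≤ |t| := Real.abs_sin_le_abs
  have := mul_le_mul h3 h1 (norm_nonneg _) (abs_nonneg _)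
  have := mul_le_mul h4 h2 (norm_nonneg _) (abs_nonneg _)
  linarith

lemma rot_dev2 {n : ℕ} {A : Mt n} (h : LocInv A) (t : ℝ) :
    ‖rot A t - 1 - (Complex.I * (t : ℂ)) • A‖ ≤ 4 * t ^ 2 := by
  have e : rot A t - 1 - (Complex.I * (t : ℂ)) • A = ((Real.cos t - 1 : ℝ) : ℂ) • (1 : Mt n)
      + (Complex.I * ((Real.sin t - t : ℝ) : ℂ)) • A := by
    simp only [rot]; push_cast; module
  rw [e]
  refine (norm_add_le _ _).trans ?_
  rw [norm_smul, norm_smul, norm_mul, Complex.norm_I, Complex.norm_real, Complex.norm_real,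
    Real.norm_eq_abs, Real.norm_eq_abs]
  have h1 := uni_one (n := n).norm_le
  have h2 := h.uni.norm_le
  have h3 := cos_err t
  have h4 := sin_err t
  have := mul_le_mul h3 h1 (norm_nonneg _) (by positivity)
  have := mul_le_mul h4 h2 (norm_nonneg _) (by positivity)
  nlinarith [sq_nonneg t]

/-! ### Gate sequences -/

inductive RM {n : ℕ} (P : Mt n → Prop) : ℕ → Mt n → Prop
  | nil : RM P 0 1
  | cons {m : ℕ} {M U : Mt n} : RM P m M → IsTwoLocalUnitary U → P (U * M) → RM P (m + 1) (U * M)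

lemma RM.comp {n : ℕ} {P Q : Mt n → Prop} {m m' : ℕ} {M M' : Mt n} (h' : RM P m' M')
    (h : RM Q m M) (hPQ : ∀ X, Q X → P (X * M')) : RM P (m' + m) (M * M') := by
  induction h with
  | nil => simpa using h'
  | @cons m M U _ hU hq ih =>
    have := hPQ _ hq
    rw [mul_assoc] at this ⊢
    exact RM.cons ih hU this

lemma RM.mono {n : ℕ} {P Q : Mt n → Prop} {m : ℕ} {M : Mt n} 
    (h : RM P m M) (hPQ : ∀ X, P X → Q X) : RM Q m M := by
  induction h with
  | nil => exact RM.nil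
  | cons _ hU hq ih => exact RM.cons ih hU (hPQ _ hq)

lemma RM.uni {n : ℕ} {P : Mt n → Prop} {m : ℕ} {M : Mt n} (h : RM P m M) : Uni M := by
  induction h with
  | nil => exact uni_one
  | cons _ hU _ ih => exact Uni.mul ⟨hU.1, hU.2.1⟩ ih

lemma RM.single {n : ℕ} {P : Mt n → Prop} {U : Mt n} (hU : IsTwoLocalUnitary U) (h : P U) :
    RM P 1 U := by
  have := RM.cons (RM.nil (P := P)) hU (by simpa using h)
  simpa using this

lemma seqApply_congr {n : ℕ} (U V : ℕ → Mt n) (ψ : (Fin n → Fin 2) → ℂ) (m : ℕ)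
    (h : ∀ i, i < m → U i = V i) : seqApply U ψ m = seqApply V ψ m := by
  induction m with
  | zero => rfl
  | succ m ih =>
    simp only [seqApply]
    rw [ih (fun i hi => h i (by omega)), h m (by omega)]

lemma RM.seq {n : ℕ} {P : Mt n → Prop} {m : ℕ} {M : Mt n} (h : RM P m M)
    (ψ : (Fin n → Fin 2) → ℂ) :
    ∃ U : ℕ → Mt n, (∀ i, i < m → IsTwoLocalUnitary (U i)) ∧ seqApply U ψ m = M.mulVec ψ ∧
      ∀ i, 1 ≤ i → i ≤ m → ∃ X, P X ∧ seqApply U ψ i = X.mulVec ψ := by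
  induction h with
  | nil => exact ⟨fun _ => 1, by simp, by simp [seqApply], by intro i h1 h2; omega⟩
  | @cons m M V _ hU hq ih =>
    obtain ⟨U, h1, h2, h3⟩ := ih
    have hc : ∀ i, i ≤ m → seqApply (fun k => if k < m then U k else V) ψ i = seqApply U ψ i := by
      intro i hi
      apply seqApply_congr
      intro k hk
      have : k < m := by omega
      simp [this]
    have hl : seqApply (fun k => if k < m then U k else V) ψ (m + 1) = (V * M).mulVec ψ := by
      simp only [seqApply, hc m le_rfl, h2, lt_irrefl, if_false, Matrix.mulVec_mulVec]
    refine ⟨fun k => if k < m then U k else V, ?_, hl, ?_⟩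
    · intro i hi
      by_cases h : i < m
      · simpa [h] using h1 i h
      · simpa [h] using hU
    · intro i hi1 hi2
      by_cases h : i ≤ m
      · obtain ⟨X, hX1, hX2⟩ := h3 i hi1 h
        exact ⟨X, hX1, by rw [hc i h, hX2]⟩
      · obtain rfl : i = m + 1 := by omega
        exact ⟨_, hq, hl⟩

/-! ### Good generators -/

def Good {n : ℕ} (l : ℕ) (D K : ℝ) (M : Mt n) : Prop :=
  ∀ τ : ℝ, ∃ m, m ≤ l ∧ ∃ X : Mt n, RM (fun Y => ‖Y - 1‖ ≤ D + 2 * |τ| * K) m X ∧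
    ‖X - 1‖ ≤ 2 * |τ| * K ∧ ‖X - 1 - (Complex.I * (τ : ℂ)) • M‖ ≤ 4 * (τ * K) ^ 2

lemma good_zero {n : ℕ} : Good 0 0 0 (0 : Mt n) := by
  intro τ
  exact ⟨0, le_rfl, 1, RM.nil, by simp, by simp⟩

lemma good_base {n : ℕ} {A : Mt n} (h : LocInv A) : Good 1 0 1 A := by
  intro τ
  have := rot_dev h τ
  exact ⟨1, le_rfl, rot A τ, RM.single (h.rot τ) (by linarith), by linarith,
    by have := rot_dev2 h τ; rw [mul_one]; exact this⟩

lemma Good.mono {n : ℕ} {l l' : ℕ} {D D' K K' : ℝ} {M : Mt n} (h : Good l D K M) (hK0 : 0 ≤ K)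
    (hl : l ≤ l') (hD : D ≤ D') (hK : K ≤ K') : Good l' D' K' M := by
  intro τ
  obtain ⟨m, hm, X, h1, h2, h3⟩ := h τ
  have hh : 2 * |τ| * K ≤ 2 * |τ| * K' := by gcongr
  refine ⟨m, hm.trans hl, X, h1.mono fun Y hY => by linarith, by linarith, h3.trans ?_⟩
  rw [mul_pow, mul_pow]
  gcongr

lemma Good.smul {n : ℕ} {l : ℕ} {D K : ℝ} {M : Mt n} (h : Good l D K M) (g : ℝ) :
    Good l D (|g| * K) ((g : ℂ) • M) := by
  intro τ
  obtain ⟨m, hm, X, h1, h2, h3⟩ := h (τ * g)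
  have e : 2 * |τ * g| * K = 2 * |τ| * (|g| * K) := by rw [abs_mul]; ring
  rw [e] at h1 h2
  refine ⟨m, hm, X, h1, h2, ?_⟩
  rw [smul_smul]
  have e1 : (τ * (|g| * K)) ^ 2 = (τ * g * K) ^ 2 := by
    rw [mul_pow, mul_pow, sq_abs]; ring
  have e2 : Complex.I * (τ : ℂ) * (g : ℂ) = Complex.I * ((τ * g : ℝ) : ℂ) := by push_cast; ring
  rw [e1, e2]; exact h3

lemma norm_mul_sub_one {n : ℕ} (X Y : Mt n) (hY : Uni Y) : ‖X * Y - 1‖ ≤ ‖X - 1‖ + ‖Y - 1‖ := by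
  have e : X * Y - 1 = (X - 1) * Y + (Y - 1) := by noncomm_ring
  rw [e]
  refine (norm_add_le _ _).trans ?_
  have := norm_mul_le (X - 1) Y
  have h1 := hY.norm_le
  nlinarith [norm_nonneg (X - 1), norm_nonneg Y]

lemma Good.add {n : ℕ} {l l' : ℕ} {D K K' : ℝ} {M M' : Mt n} (h : Good l D K M)
    (h' : Good l' D K' M') (hK : 0 ≤ K) (hK' : 0 ≤ K') : Good (l + l') D (K + K') (M + M') := by
  intro τ
  obtain ⟨m, hm, X, h1, h2, h3⟩ := h τ
  obtain ⟨m', hm', X', h1', h2', h3'⟩ := h' τ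
  have ht := abs_nonneg τ
  have p1 : 0 ≤ |τ| * K := by positivity
  have p2 : 0 ≤ |τ| * K' := by positivity
  refine ⟨m + m', by omega, X' * X, ?_, ?_, ?_⟩
  · refine RM.comp (h1.mono ?_) h1' ?_
    · intro Y hY; linarith
    · intro Y hY
      have := norm_mul_sub_one Y X h1.uni
      linarith
  · have := norm_mul_sub_one X' X h1.uni
    linarith
  · have e : X' * X - 1 - (Complex.I * (τ : ℂ)) • (M + M') =
      (X - 1 - (Complex.I * (τ : ℂ)) • M) + (X' - 1 - (Complex.I * (τ : ℂ)) • M')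
        + (X' - 1) * (X - 1) := by
      rw [smul_add]; noncomm_ring
    rw [e]
    have q1 := norm_add₃_le (a := X - 1 - (Complex.I * (τ : ℂ)) • M)
      (b := X' - 1 - (Complex.I * (τ : ℂ)) • M') (c := (X' - 1) * (X - 1))
    have q2 := norm_mul_le (X' - 1) (X - 1)
    have q3 := mul_le_mul h2' h2 (norm_nonneg _) (by positivity)
    have q4 : 2 * |τ| * K' * (2 * |τ| * K) = 4 * (τ ^ 2 * (K * K')) := by rw [← sq_abs τ]; ring
    have q5 : 0 ≤ τ ^ 2 * (K * K') := by positivity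
    nlinarith

lemma good_sum {n : ℕ} {ι : Type*} (s : Finset ι) (M : ι → Mt n) (c : ι → ℝ) {l : ℕ} {D K : ℝ}
    (hD : 0 ≤ D) (hK : 0 ≤ K) (h : ∀ i ∈ s, Good l D K (M i)) :
    Good (s.card * l) D ((∑ i ∈ s, |c i|) * K) (∑ i ∈ s, ((c i : ℝ) : ℂ) • M i) := by
  classical
  induction s using Finset.induction_on with
  | empty => simpa using good_zero.mono le_rfl (le_refl 0) hD le_rfl
  | insert a s ha ih =>
    rw [Finset.sum_insert ha, Finset.sum_insert ha, Finset.card_insert_of_notMem ha]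
    have h1 := (h a (by simp)).smul (c a)
    have h2 := ih (fun i hi => h i (by simp [hi]))
    have := h1.add h2 (by positivity) (by positivity)
    rw [add_mul, add_mul, one_mul, add_comm (s.card * l)]
    exact this

lemma Good.conj {n : ℕ} {l : ℕ} {D K b : ℝ} {M B : Mt n} (h : Good l D K M) (hB : LocInv B)
    (hD : 0 ≤ D) (hK : 0 ≤ K) :
    Good (l + 2) (D + 4 * |b|) K (rot B b * M * rot B (-b)) := by
  intro τ
  obtain ⟨m, hm, X, h1, h2, h3⟩ := h τ
  have p1 : 0 ≤ |τ| * K := by positivity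
  have hb := abs_nonneg b
  have d1 := rot_dev hB b
  have d2 := rot_dev hB (-b)
  rw [abs_neg] at d2
  have u1 : Uni (rot B b) := rot_uni B hB.1 hB.2.1 b
  have u2 : Uni (rot B (-b)) := rot_uni B hB.1 hB.2.1 (-b)
  have hinv : rot B b * rot B (-b) = 1 := by rw [rot_mul B hB.2.1]; simp [rot_zero]
  have key : ∀ Y : Mt n, ‖rot B b * Y * rot B (-b)‖ ≤ ‖Y‖ := by
    intro Y
    have q1 := norm_mul_le (rot B b * Y) (rot B (-b))
    have q2 := norm_mul_le (rot B b) Y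
    have := u1.norm_le
    have := u2.norm_le
    have := norm_nonneg Y
    have := norm_nonneg (rot B b)
    have := norm_nonneg (rot B (-b))
    have := norm_nonneg (rot B b * Y)
    nlinarith
  refine ⟨1 + m + 1, by omega, rot B b * (X * rot B (-b)), ?_, ?_, ?_⟩
  · refine RM.cons (RM.comp (RM.single (hB.rot (-b)) (by linarith)) h1 ?_) (hB.rot b) ?_
    · intro Y hY
      have := norm_mul_sub_one Y _ u2
      linarith
    · have := norm_mul_sub_one (rot B b) _ (h1.uni.mul u2)
      have := norm_mul_sub_one X _ u2
      linarith
  · have := key (X - 1)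
    rw [mul_sub, sub_mul, mul_one, hinv] at this
    rw [← mul_assoc]; linarith
  · have := key (X - 1 - (Complex.I * (τ : ℂ)) • M)
    rw [mul_sub, mul_sub, sub_mul, sub_mul, mul_one, hinv, mul_smul_comm, smul_mul_assoc] at this
    rw [← mul_assoc]; linarith

lemma Good.comm {n : ℕ} {l : ℕ} {D K b : ℝ} {M B P : Mt n} (h : Good l D K M) (hB : LocInv B)
    (hD : 0 ≤ D) (hK : 0 ≤ K) (hb : 0 ≤ b) (hs : 0 < Real.sin (2 * b))
    (h1 : B * M = Complex.I • P) (h2 : M * B = -Complex.I • P) :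
    Good (2 * (l + 2)) (D + 4 * b) (K * (Real.sin (2 * b))⁻¹) P := by
  have g1 := (h.conj (b := b) hB hD hK).smul (-(Real.sin (2 * b))⁻¹ / 2)
  have g2 := (h.conj (b := -b) hB hD hK).smul ((Real.sin (2 * b))⁻¹ / 2)
  rw [abs_neg] at g2
  rw [abs_of_nonneg hb] at g1 g2
  have := g1.add g2 (by positivity) (by positivity)
  have e1 : |-(Real.sin (2 * b))⁻¹ / 2| = (Real.sin (2 * b))⁻¹ / 2 := by
    rw [neg_div, abs_neg, abs_of_pos (by positivity)]
  have e2 : |(Real.sin (2 * b))⁻¹ / 2| = (Real.sin (2 * b))⁻¹ / 2 := abs_of_pos (by positivity)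
  rw [e1, e2] at this
  have e3 : (((-(Real.sin (2 * b))⁻¹ / 2 : ℝ) : ℂ) • (rot B b * M * rot B (-b)) +
      (((Real.sin (2 * b))⁻¹ / 2 : ℝ) : ℂ) • (rot B (-b) * M * rot B (- -b))) = P := by
    have e4 : rot B b * M * rot B (-b) - rot B (-b) * M * rot B (- -b) =
        (-2 * (Real.sin (2 * b) : ℂ)) • P := by
      simp only [rot, add_mul, mul_add, smul_mul_assoc, mul_smul_comm, one_mul, mul_one, neg_neg,
        Real.cos_neg, Real.sin_neg, smul_smul, h1, h2, Real.sin_two_mul]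
      push_cast
      have hI : Complex.I * Complex.I = -1 := Complex.I_mul_I
      match_scalars
      · ring
      · linear_combination (4 * Complex.cos b * Complex.sin b) * hI
      · ring
    have e5 : (((Real.sin (2 * b))⁻¹ / 2 : ℝ) : ℂ) * (-2 * (Real.sin (2 * b) : ℂ)) = -1 := by
      have : (Real.sin (2 * b) : ℂ) ≠ 0 := by exact_mod_cast hs.ne'
      push_cast at this ⊢
      field_simp
    have e6 := congrArg (fun Z => (((Real.sin (2 * b))⁻¹ / 2 : ℝ) : ℂ) • Z) e4
    simp only [smul_smul, e5, smul_sub] at e6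
    rw [neg_div, Complex.ofReal_neg, neg_smul]
    rw [neg_one_smul] at e6
    rw [← neg_eq_iff_eq_neg] at e6
    rw [← e6]; abel
  rw [e3] at this
  refine this.mono (by positivity) (by omega) le_rfl (le_of_eq (by ring))

/-! ### Pauli strings -/

noncomputable def tens {n : ℕ} (m : Fin n → Matrix (Fin 2) (Fin 2) ℂ) : Mt n :=
  Matrix.of fun x y => ∏ k, m k (x k) (y k)

lemma tens_mul {n : ℕ} (m m' : Fin n → Matrix (Fin 2) (Fin 2) ℂ) :
    tens m * tens m' = tens (fun k => m k * m' k) := by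
  ext x y
  simp only [tens, Matrix.mul_apply, Matrix.of_apply]
  rw [Finset.prod_univ_sum, Fintype.piFinset_univ]
  simp only [Finset.prod_mul_distrib]

lemma tens_star {n : ℕ} (m : Fin n → Matrix (Fin 2) (Fin 2) ℂ) :
    (tens m)ᴴ = tens (fun k => (m k)ᴴ) := by
  ext x y
  simp [tens, Matrix.conjTranspose_apply]

lemma tens_one {n : ℕ} : tens (fun _ : Fin n => (1 : Matrix (Fin 2) (Fin 2) ℂ)) = 1 := by
  ext x y
  simp only [tens, Matrix.of_apply, Matrix.one_apply]
  by_cases h : x = y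
  · subst h; simp
  · rw [if_neg h]
    obtain ⟨k, hk⟩ := Function.ne_iff.1 h
    exact Finset.prod_eq_zero (Finset.mem_univ k) (by simp [hk])

lemma tens_scale {n : ℕ} (m m' : Fin n → Matrix (Fin 2) (Fin 2) ℂ) (i : Fin n) (c : ℂ)
    (hi : m i = c • m' i) (h : ∀ k, k ≠ i → m k = m' k) : tens m = c • tens m' := by
  ext x y
  simp only [tens, Matrix.of_apply, Matrix.smul_apply, smul_eq_mul]
  rw [← Finset.mul_prod_erase _ _ (Finset.mem_univ i), ← Finset.mul_prod_erase _ _ (Finset.mem_univ i),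
    hi, ← mul_assoc]
  congr 1
  refine Finset.prod_congr rfl fun k hk => ?_
  rw [h k (Finset.ne_of_mem_erase hk)]

noncomputable def sg (a : Fin 4) : Matrix (Fin 2) (Fin 2) ℂ :=
  ![1, !![0, 1; 1, 0], !![0, -Complex.I; Complex.I, 0], !![1, 0; 0, -1]] a

lemma sg_zero : sg 0 = 1 := rfl

lemma sg_star (a : Fin 4) : (sg a)ᴴ = sg a := by
  fin_cases a <;> ext i j <;> fin_cases i <;> fin_cases j <;> simp [sg]

lemma sg_sq (a : Fin 4) : sg a * sg a = 1 := by
  fin_cases a <;> ext i j <;> fin_cases i <;> fin_cases j <;> simp [sg]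

lemma sg_comm (a : Fin 4) (ha : a ≠ 0) : ∃ q r : Fin 4, sg q * sg r = Complex.I • sg a ∧
    sg r * sg q = -Complex.I • sg a := by
  fin_cases a
  · exact absurd rfl ha
  · refine ⟨2, 3, ?_, ?_⟩ <;> ext i j <;> fin_cases i <;> fin_cases j <;> simp [sg]
  · refine ⟨3, 1, ?_, ?_⟩ <;> ext i j <;> fin_cases i <;> fin_cases j <;> simp [sg]
  · refine ⟨1, 2, ?_, ?_⟩ <;> ext i j <;> fin_cases i <;> fin_cases j <;> simp [sg]

lemma sg_complete (x y x' y' : Fin 2) : ∑ a, sg a x y * star (sg a x' y') =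
    if x = x' ∧ y = y' then 2 else 0 := by
  fin_cases x <;> fin_cases y <;> fin_cases x' <;> fin_cases y' <;>
    simp [sg, Fin.sum_univ_four] <;> norm_num

lemma sg_norm (a : Fin 4) (x y : Fin 2) : ‖sg a x y‖ ≤ 1 := by
  fin_cases a <;> fin_cases x <;> fin_cases y <;> simp [sg]

noncomputable def pauli {n : ℕ} (p : Fin n → Fin 4) : Mt n := tens (fun k => sg (p k))

lemma pauli_star {n : ℕ} (p : Fin n → Fin 4) : (pauli p)ᴴ = pauli p := by
  simp [pauli, tens_star, sg_star]

lemma pauli_sq {n : ℕ} (p : Fin n → Fin 4) : pauli p * pauli p = 1 := by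
  simp [pauli, tens_mul, sg_sq, tens_one]

lemma pauli_norm {n : ℕ} (p : Fin n → Fin 4) (x y : Fin n → Fin 2) : ‖pauli p x y‖ ≤ 1 := by
  simp only [pauli, tens, Matrix.of_apply, norm_prod]
  exact Finset.prod_le_one (fun _ _ => norm_nonneg _) (fun _ _ => sg_norm _ _ _)

lemma pauli_complete {n : ℕ} (x y x' y' : Fin n → Fin 2) :
    ∑ p, pauli p x y * star (pauli p x' y') = if x = x' ∧ y = y' then 2 ^ n else 0 := by
  have h := Finset.prod_univ_sum (R := ℂ) (fun _ : Fin n => (Finset.univ : Finset (Fin 4)))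
    (fun k a => sg a (x k) (y k) * star (sg a (x' k) (y' k)))
  rw [Fintype.piFinset_univ] at h
  simp only [pauli, tens, Matrix.of_apply, star_prod, ← Finset.prod_mul_distrib]
  rw [← h]
  simp only [sg_complete]
  split_ifs with hc
  · obtain ⟨rfl, rfl⟩ := hc; simp
  · have : ∃ k, ¬ (x k = x' k ∧ y k = y' k) := by
      by_contra hh; push Not at hh
      exact hc ⟨funext fun k => (hh k).1, funext fun k => (hh k).2⟩
    obtain ⟨k, hk⟩ := this
    exact Finset.prod_eq_zero (Finset.mem_univ k) (by rw [if_neg hk])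

lemma loc_two {n : ℕ} (p : Fin n → Fin 4) (i j : Fin n) (hij : i ≠ j)
    (h : ∀ k, k ≠ i → k ≠ j → p k = 0) : LocInv (pauli p) := by
  refine ⟨pauli_star p, pauli_sq p, i, j, Matrix.kroneckerMap (· * ·) (sg (p i)) (sg (p j)), ?_, ?_, ?_⟩
  · rw [Matrix.conjTranspose_kronecker, sg_star, sg_star]
  · rw [← Matrix.mul_kronecker_mul, sg_sq, sg_sq, Matrix.one_kronecker_one]
  · intro x y
    simp only [pauli, tens, Matrix.of_apply, Matrix.kroneckerMap_apply]
    split_ifs with hc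
    · rw [← Finset.mul_prod_erase _ _ (Finset.mem_univ i),
        ← Finset.mul_prod_erase _ _ (Finset.mem_erase.2 ⟨hij.symm, Finset.mem_univ j⟩)]
      rw [Finset.prod_eq_one, mul_one]
      intro k hk
      simp only [Finset.mem_erase, Finset.mem_univ, and_true] at hk
      rw [h k hk.2 hk.1, hc k hk.2 hk.1, sg_zero]; simp
    · push Not at hc
      obtain ⟨k, hk1, hk2, hk3⟩ := hc
      exact Finset.prod_eq_zero (Finset.mem_univ k) (by rw [h k hk1 hk2, sg_zero]; simp [hk3])

lemma loc_one {n : ℕ} (p : Fin n → Fin 4) (i : Fin n)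
    (h : ∀ k, k ≠ i → p k = 0) : LocInv (pauli p) := by
  refine ⟨pauli_star p, pauli_sq p, i, i,
    Matrix.of fun u v => sg (p i) u.1 v.1 * if u.1 + u.2 = v.1 + v.2 then 1 else 0, ?_, ?_, ?_⟩
  · generalize p i = a
    ext ⟨u1, u2⟩ ⟨v1, v2⟩
    fin_cases a <;> fin_cases u1 <;> fin_cases u2 <;> fin_cases v1 <;> fin_cases v2 <;> simp [sg]
  · generalize p i = a
    ext ⟨u1, u2⟩ ⟨v1, v2⟩
    rw [Matrix.mul_apply, Fintype.sum_prod_type]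
    simp only [Fin.sum_univ_two]
    fin_cases a <;> fin_cases u1 <;> fin_cases u2 <;> fin_cases v1 <;> fin_cases v2 <;>
      simp [sg, Matrix.one_apply]
  · intro x y
    simp only [pauli, tens, Matrix.of_apply]
    split_ifs with hc h2 h2
    · rw [← Finset.mul_prod_erase _ _ (Finset.mem_univ i)]
      rw [Finset.prod_eq_one]
      intro k hk
      simp only [Finset.mem_erase, Finset.mem_univ, and_true] at hk
      rw [h k hk, hc k hk hk, sg_zero]; simp
    · exfalso; apply h2
      generalize x i = a
      generalize y i = b
      revert a b; decide
    · push Not at hc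
      obtain ⟨k, hk1, hk2, hk3⟩ := hc
      exact Finset.prod_eq_zero (Finset.mem_univ k) (by rw [h k hk1, sg_zero]; simp [hk3])

lemma good_pauli {n : ℕ} (hn : 1 ≤ n) (b : ℝ) (hb : 0 ≤ b) (hs : 0 < Real.sin (2 * b)) (k : ℕ) :
    ∀ p : Fin n → Fin 4, (Finset.univ.filter fun j => p j ≠ 0).card ≤ k + 1 →
      Good (5 * 2 ^ k - 4) (4 * b * k) ((Real.sin (2 * b))⁻¹ ^ k) (pauli p) := by
  have hs1 : 1 ≤ (Real.sin (2 * b))⁻¹ := (one_le_inv₀ hs).2 (Real.sin_le_one _)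
  induction k with
  | zero =>
    intro p hp
    have : ∃ i, ∀ k, k ≠ i → p k = 0 := by
      haveI : Nonempty (Fin n) := ⟨⟨0, hn⟩⟩
      rw [zero_add, Finset.card_le_one_iff_subset_singleton] at hp
      obtain ⟨i, hi⟩ := hp
      refine ⟨i, fun k hk => ?_⟩
      by_contra hh
      have := hi (Finset.mem_filter.2 ⟨Finset.mem_univ k, hh⟩)
      exact hk (Finset.mem_singleton.1 this)
    obtain ⟨i, hi⟩ := this
    simpa using good_base (loc_one p i hi)
  | succ k ih =>
    intro p hp
    have hpw : 1 ≤ 2 ^ k := Nat.one_le_two_pow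
    by_cases hc : (Finset.univ.filter fun j => p j ≠ 0).card ≤ k + 1
    · refine (ih p hc).mono (by positivity) (by rw [pow_succ]; omega) ?_ ?_
      · push_cast; nlinarith
      · rw [pow_succ]; nlinarith [pow_pos (lt_of_lt_of_le one_pos hs1) k]
    · have h1 : 1 < (Finset.univ.filter fun j => p j ≠ 0).card := by omega
      obtain ⟨i, hi, j, hj, hij⟩ := Finset.one_lt_card.1 h1
      simp only [Finset.mem_filter, Finset.mem_univ, true_and] at hi hj
      obtain ⟨q, r, hq, hr⟩ := sg_comm (p i) hi
      set p' : Fin n → Fin 4 := Function.update (Function.update p i r) j 0 with hp'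
      set u : Fin n → Fin 4 := Function.update (Function.update (fun _ => 0) i q) j (p j) with hu
      have hB : LocInv (pauli u) := loc_two u i j hij (by
        intro k h1 h2; simp [hu, h1, h2])
      have hcard : (Finset.univ.filter fun j => p' j ≠ 0).card ≤ k + 1 := by
        have hsub : (Finset.univ.filter fun j => p' j ≠ 0) ⊆
            (Finset.univ.filter fun j => p j ≠ 0).erase j := by
          intro k hk
          simp only [Finset.mem_filter, Finset.mem_univ, true_and, Finset.mem_erase] at hk ⊢
          by_cases h1 : k = j
          · subst h1; simp [hp'] at hk
          · refine ⟨h1, ?_⟩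
            by_cases h2 : k = i
            · subst h2; exact hi
            · simpa [hp', h1, h2] using hk
        have := Finset.card_le_card hsub
        rw [Finset.card_erase_of_mem (by simp [hj])] at this
        omega
      have g := ih p' hcard
      have := g.comm (P := pauli p) hB (by positivity) (by positivity) hb hs ?_ ?_
      · rw [← pow_succ] at this
        refine this.mono (by positivity) (by rw [pow_succ 2 k]; omega) ?_ le_rfl
        push_cast; linarith
      · unfold pauli; rw [tens_mul]
        refine tens_scale _ _ i _ ?_ ?_
        · simp [hu, hp', hij, hq]
        · intro k hk
          by_cases h1 : k = j
          · subst h1; simp [hu, hp', sg_zero]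
          · simp [hu, hp', hk, h1, sg_zero]
      · unfold pauli; rw [tens_mul]
        refine tens_scale _ _ i _ ?_ ?_
        · simpa [hu, hp', hij] using hr
        · intro k hk
          by_cases h1 : k = j
          · subst h1; simp [hu, hp', sg_zero]
          · simp [hu, hp', hk, h1, sg_zero]

lemma herm_expand {n : ℕ} (G : Mt n) (hG : Gᴴ = G) (hG1 : ∀ x y, ‖G x y‖ ≤ 2) :
    ∃ c : (Fin n → Fin 4) → ℝ, (∀ p, |c p| ≤ 2 * 2 ^ n) ∧
      G = ∑ p, ((c p : ℝ) : ℂ) • pauli p := by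
  set t : (Fin n → Fin 4) → ℂ := fun p => ∑ x, ∑ y, star (pauli p x y) * G x y with ht
  have hreal : ∀ p, star (t p) = t p := by
    intro p
    simp only [ht, star_sum, star_mul', star_star]
    rw [Finset.sum_comm]
    refine Finset.sum_congr rfl fun y _ => Finset.sum_congr rfl fun x _ => ?_
    have h1 : star (G x y) = G y x := by rw [← Matrix.conjTranspose_apply, hG]
    have h2 : star (pauli p y x) = pauli p x y := by
      rw [← Matrix.conjTranspose_apply, pauli_star]
    rw [h1, h2]
  have hre : ∀ p, ((t p).re : ℂ) = t p := fun p => Complex.conj_eq_iff_re.1 (hreal p)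
  refine ⟨fun p => (t p).re / 2 ^ n, ?_, ?_⟩
  · intro p
    have h1 : ‖t p‖ ≤ 2 ^ n * 2 ^ n * 2 := by
      have : ∀ x y : Fin n → Fin 2, ‖star (pauli p x y) * G x y‖ ≤ 2 := by
        intro x y
        rw [norm_mul, norm_star]
        nlinarith [pauli_norm p x y, hG1 x y, norm_nonneg (pauli p x y), norm_nonneg (G x y)]
      calc ‖t p‖ ≤ ∑ x : Fin n → Fin 2, ∑ y : Fin n → Fin 2, ‖star (pauli p x y) * G x y‖ :=
            (norm_sum_le _ _).trans (Finset.sum_le_sum fun x _ => norm_sum_le _ _)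
        _ ≤ ∑ x : Fin n → Fin 2, ∑ y : Fin n → Fin 2, 2 :=
            Finset.sum_le_sum fun x _ => Finset.sum_le_sum fun y _ => this x y
        _ = 2 ^ n * 2 ^ n * 2 := by simp; ring
    have h2 := Complex.abs_re_le_norm (t p)
    rw [abs_div, abs_of_pos (by positivity : (0:ℝ) < 2 ^ n), div_le_iff₀ (by positivity)]
    linarith
  · ext x y
    rw [Matrix.sum_apply]
    have h1 : ∀ p, ((((t p).re / 2 ^ n : ℝ) : ℂ) • pauli p) x y = 
      (2 ^ n : ℂ)⁻¹ * ∑ x', ∑ y', (pauli p x y * star (pauli p x' y')) * G x' y' := by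
      intro p
      rw [Matrix.smul_apply, smul_eq_mul]
      push_cast
      rw [hre, ht]
      simp only [mul_assoc, ← Finset.mul_sum]
      field_simp
    rw [Finset.sum_congr rfl fun p _ => h1 p, ← Finset.mul_sum, Finset.sum_comm]
    have h2 : ∀ x', ∑ p, ∑ y', (pauli p x y * star (pauli p x' y')) * G x' y' =
        ∑ y', (if x = x' ∧ y = y' then 2 ^ n else 0) * G x' y' := by
      intro x'
      rw [Finset.sum_comm]
      refine Finset.sum_congr rfl fun y' _ => ?_
      rw [← Finset.sum_mul, pauli_complete]
    rw [Finset.sum_congr rfl fun p _ => h2 p]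
    rw [Finset.sum_eq_single x, Finset.sum_eq_single y]
    · simp
    · intro b _ hb; simp [hb.symm]
    · simp
    · intro b _ hb; simp [hb.symm]
    · simp

lemma good_herm {n : ℕ} (hn : 1 ≤ n) (b : ℝ) (hb : 0 ≤ b) (hs : 0 < Real.sin (2 * b))
    (G : Mt n) (hG : Gᴴ = G) (hG1 : ∀ x y, ‖G x y‖ ≤ 2) :
    Good (4 ^ n * (5 * 2 ^ n)) (4 * b * n) (2 * 8 ^ n * (Real.sin (2 * b))⁻¹ ^ (n - 1)) G := by
  obtain ⟨c, hc, rfl⟩ := herm_expand G hG hG1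
  have := good_sum Finset.univ (fun p : Fin n → Fin 4 => pauli p) c (l := 5 * 2 ^ (n - 1) - 4)
    (D := 4 * b * (n - 1 : ℕ)) (K := (Real.sin (2 * b))⁻¹ ^ (n - 1)) (by positivity) (by positivity)
    (fun p _ => good_pauli hn b hb hs (n - 1) p
      (by refine (Finset.card_le_univ _).trans ?_; simp; omega))
  refine this.mono (by positivity) ?_ ?_ ?_
  · simp only [Finset.card_univ, Fintype.card_pi, Fintype.card_fin, Finset.prod_const]
    refine Nat.mul_le_mul le_rfl ?_
    have : 2 ^ (n - 1) ≤ 2 ^ n := Nat.pow_le_pow_right (by norm_num) (by omega)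
    omega
  · have : ((n - 1 : ℕ) : ℝ) ≤ n := by exact_mod_cast Nat.sub_le n 1
    nlinarith
  · refine mul_le_mul_of_nonneg_right ?_ (by positivity)
    calc ∑ p, |c p| ≤ ∑ p : Fin n → Fin 4, 2 * (2:ℝ) ^ n := Finset.sum_le_sum fun p _ => hc p
      _ = 2 * 8 ^ n := by
        simp only [Finset.sum_const, Finset.card_univ, Fintype.card_pi, Fintype.card_fin,
          Finset.prod_const, nsmul_eq_mul]
        push_cast
        rw [show (8:ℝ) = 4 * 2 by norm_num, mul_pow]; ring

/-! ### Vectors -/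

noncomputable def vn {n : ℕ} (v : (Fin n → Fin 2) → ℂ) : ℝ :=
  ‖(WithLp.toLp 2 v : EuclideanSpace ℂ (Fin n → Fin 2))‖

lemma vn_eq {n : ℕ} (v : (Fin n → Fin 2) → ℂ) : _root_.enorm v = vn v := by
  rw [vn, EuclideanSpace.norm_eq]; rfl

lemma vn_nonneg {n : ℕ} (v : (Fin n → Fin 2) → ℂ) : 0 ≤ vn v := norm_nonneg _

lemma vn_add {n : ℕ} (u v : (Fin n → Fin 2) → ℂ) : vn (u + v) ≤ vn u + vn v := by
  simp only [vn, WithLp.toLp_add]; exact norm_add_le _ _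

lemma vn_smul {n : ℕ} (c : ℂ) (v : (Fin n → Fin 2) → ℂ) : vn (c • v) = ‖c‖ * vn v := by
  simp only [vn, WithLp.toLp_smul]; exact norm_smul _ _

lemma vn_mulVec {n : ℕ} (A : Mt n) (v : (Fin n → Fin 2) → ℂ) : vn (A.mulVec v) ≤ ‖A‖ * vn v :=
  Matrix.l2_opNorm_mulVec A (WithLp.toLp 2 v)

lemma vn_entry {n : ℕ} (v : (Fin n → Fin 2) → ℂ) (x : Fin n → Fin 2) : ‖v x‖ ≤ vn v :=
  PiLp.norm_apply_le (WithLp.toLp 2 v : EuclideanSpace ℂ (Fin n → Fin 2)) x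

lemma vn_eq_zero {n : ℕ} (v : (Fin n → Fin 2) → ℂ) (h : vn v = 0) : v = 0 := by
  have := norm_eq_zero.1 h
  simpa using this

lemma ip_eq {n : ℕ} (u v : (Fin n → Fin 2) → ℂ) : ip u v = star u ⬝ᵥ v := rfl

lemma ip_self {n : ℕ} (v : (Fin n → Fin 2) → ℂ) : ip v v = ((vn v ^ 2 : ℝ) : ℂ) := by
  rw [← vn_eq, _root_.enorm, Real.sq_sqrt (by positivity), ip]
  push_cast
  refine Finset.sum_congr rfl fun x _ => ?_
  exact Complex.conj_mul' (v x)

lemma ip_conj {n : ℕ} (u v : (Fin n → Fin 2) → ℂ) : ip v u = star (ip u v) := by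
  simp [ip, mul_comm]

/-- real part of the form -/
noncomputable def Bf {n : ℕ} (H : Mt n) (u v : (Fin n → Fin 2) → ℂ) : ℝ := (ip u (H.mulVec v)).re

lemma Bf_comb {n : ℕ} (H : Mt n) (hH : H.IsHermitian) (u v : (Fin n → Fin 2) → ℂ) (a b : ℝ) :
    Bf H ((a : ℂ) • u + (b : ℂ) • v) ((a : ℂ) • u + (b : ℂ) • v) =
      a ^ 2 * Bf H u u + b ^ 2 * Bf H v v + 2 * a * b * Bf H u v := by
  have hsym : Bf H v u = Bf H u v := by
    unfold Bf
    rw [ip_eq, ip_eq, Matrix.star_dotProduct, Matrix.star_mulVec, hH.eq,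
      ← Matrix.dotProduct_mulVec]
    exact Complex.conj_re _
  have key : ip ((a : ℂ) • u + (b : ℂ) • v) (H.mulVec ((a : ℂ) • u + (b : ℂ) • v)) =
      ((a ^ 2 : ℝ) : ℂ) * ip u (H.mulVec u) + ((b ^ 2 : ℝ) : ℂ) * ip v (H.mulVec v) +
        ((a * b : ℝ) : ℂ) * ip u (H.mulVec v) + ((a * b : ℝ) : ℂ) * ip v (H.mulVec u) := by
    simp only [ip_eq, Matrix.mulVec_add, Matrix.mulVec_smul, star_add, star_smul, add_dotProduct,
      dotProduct_add, smul_dotProduct, dotProduct_smul, smul_eq_mul]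
    have h1 : star (a : ℂ) = a := Complex.conj_ofReal a
    have h2 : star (b : ℂ) = b := Complex.conj_ofReal b
    rw [h1, h2]
    push_cast
    ring
  have k2 := congrArg Complex.re key
  simp only [Complex.add_re, Complex.re_ofReal_mul] at k2
  unfold Bf at hsym ⊢
  rw [k2, hsym]; ring

lemma Bf_phase {n : ℕ} (H : Mt n) (v : (Fin n → Fin 2) → ℂ) (c : ℂ) (hc : ‖c‖ = 1) :
    Bf H (c • v) (c • v) = Bf H v v := by
  have h1 : star c * c = 1 := by
    have := Complex.conj_mul' c
    rw [hc] at this; simpa using this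
  unfold Bf
  rw [ip_eq, ip_eq, Matrix.mulVec_smul, star_smul, smul_dotProduct, dotProduct_smul, smul_smul, h1,
    one_smul]

lemma walk {n : ℕ} (ψ q : (Fin n → Fin 2) → ℂ) (G : Mt n) (l : ℕ) (D K τ : ℝ) (hG : Good l D K G)
    (hK : 1 ≤ K) (hτ : 0 ≤ τ) (hψ : vn ψ = 1) (hq : vn q = 1)
    (hGψ : (Complex.I • G).mulVec ψ = q) (hGq : (Complex.I • G).mulVec q = -ψ) (N : ℕ)
    (P : ((Fin n → Fin 2) → ℂ) → Prop)
    (hP : ∀ s : ℕ, s ≤ N → ∀ e, vn e ≤ N * (16 * τ ^ 2 * K ^ 2) + D + 2 * τ * K →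
      P (((Real.cos (s * τ) : ℝ) : ℂ) • ψ + ((Real.sin (s * τ) : ℝ) : ℂ) • q + e)) :
    ∀ s : ℕ, s ≤ N → ∃ m, m ≤ s * l ∧ ∃ M : Mt n, RM (fun X => P (X.mulVec ψ)) m M ∧
      vn (M.mulVec ψ - (((Real.cos (s * τ) : ℝ) : ℂ) • ψ + ((Real.sin (s * τ) : ℝ) : ℂ) • q))
        ≤ s * (16 * τ ^ 2 * K ^ 2) := by
  intro s
  induction s with
  | zero =>
    intro _
    refine ⟨0, by simp, 1, RM.nil, ?_⟩
    simp [vn]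
  | succ s ih =>
    intro hs
    obtain ⟨m, hm, M, hR, hM⟩ := ih (by omega)
    obtain ⟨m', hm', X, hRX, hX1, hX2⟩ := hG τ
    rw [abs_of_nonneg hτ] at hRX hX1
    set p := ((Real.cos (s * τ) : ℝ) : ℂ) • ψ + ((Real.sin (s * τ) : ℝ) : ℂ) • q with hp
    have hsN : (s : ℝ) ≤ N := by exact_mod_cast (by omega : s ≤ N)
    have hE : 0 ≤ 16 * τ ^ 2 * K ^ 2 := by positivity
    have hp2 : vn p ≤ 2 := by
      refine (vn_add _ _).trans ?_
      rw [vn_smul, vn_smul, hψ, hq, Complex.norm_real, Complex.norm_real, Real.norm_eq_abs,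
        Real.norm_eq_abs]
      linarith [Real.abs_cos_le_one (s * τ), Real.abs_sin_le_one (s * τ)]
    have hMψ : vn (M.mulVec ψ) ≤ 1 := by
      have := vn_mulVec M ψ
      rw [hψ] at this
      linarith [hR.uni.norm_le]
    refine ⟨m + m', by rw [add_mul]; omega, X * M, ?_, ?_⟩
    · refine hR.comp hRX ?_
      intro Y hY
      have e1 : (Y * M).mulVec ψ = p + ((Y - 1).mulVec (M.mulVec ψ) + (M.mulVec ψ - p)) := by
        rw [Matrix.sub_mulVec, Matrix.one_mulVec, Matrix.mulVec_mulVec]; abel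
      rw [e1]
      apply hP s (by omega)
      refine (vn_add _ _).trans ?_
      have h1 := vn_mulVec (Y - 1) (M.mulVec ψ)
      have h2 : ‖Y - 1‖ * vn (M.mulVec ψ) ≤ (D + 2 * τ * K) * 1 :=
        mul_le_mul hY hMψ (vn_nonneg _) ((norm_nonneg _).trans hY)
      have h3 : (s : ℝ) * (16 * τ ^ 2 * K ^ 2) ≤ N * (16 * τ ^ 2 * K ^ 2) := by gcongr
      linarith
    · set p1 := ((Real.cos ((s + 1 : ℕ) * τ) : ℝ) : ℂ) • ψ + ((Real.sin ((s + 1 : ℕ) * τ) : ℝ) : ℂ) • q with hp1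
      set d := ((Real.cos (s * τ) : ℝ) : ℂ) • q - ((Real.sin (s * τ) : ℝ) : ℂ) • ψ with hd
      have hd2 : vn d ≤ 2 := by
        rw [hd, sub_eq_add_neg, ← neg_smul]
        refine (vn_add _ _).trans ?_
        rw [vn_smul, vn_smul, hψ, hq, norm_neg, Complex.norm_real, Complex.norm_real,
          Real.norm_eq_abs, Real.norm_eq_abs]
        linarith [Real.abs_cos_le_one (s * τ), Real.abs_sin_le_one (s * τ)]
      have hGp : (Complex.I • G).mulVec p = d := by
        rw [hp, Matrix.mulVec_add, Matrix.mulVec_smul, Matrix.mulVec_smul, hGψ, hGq, hd, smul_neg,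
          sub_eq_add_neg]
      have hp1' : p1 = ((Real.cos τ : ℝ) : ℂ) • p + ((Real.sin τ : ℝ) : ℂ) • d := by
        have : ((s + 1 : ℕ) : ℝ) * τ = s * τ + τ := by push_cast; ring
        rw [hp1, hp, hd, this, Real.cos_add, Real.sin_add]
        push_cast
        module
      have e1 : (X * M).mulVec ψ - p1 = X.mulVec (M.mulVec ψ - p) +
          ((X - 1 - (Complex.I * (τ : ℂ)) • G).mulVec p +
            (((1 - Real.cos τ : ℝ) : ℂ) • p + ((τ - Real.sin τ : ℝ) : ℂ) • d)) := by
        have e2 : ((Complex.I * (τ : ℂ)) • G).mulVec p = (τ : ℂ) • d := by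
          rw [mul_comm, ← smul_smul, Matrix.smul_mulVec, hGp]
        rw [Matrix.sub_mulVec, Matrix.sub_mulVec, e2, Matrix.one_mulVec, Matrix.mulVec_sub,
          Matrix.mulVec_mulVec, hp1']
        push_cast
        module
      rw [e1]
      have t1 := vn_add (X.mulVec (M.mulVec ψ - p)) ((X - 1 - (Complex.I * (τ : ℂ)) • G).mulVec p +
            (((1 - Real.cos τ : ℝ) : ℂ) • p + ((τ - Real.sin τ : ℝ) : ℂ) • d))
      have t2 := vn_add ((X - 1 - (Complex.I * (τ : ℂ)) • G).mulVec p)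
            (((1 - Real.cos τ : ℝ) : ℂ) • p + ((τ - Real.sin τ : ℝ) : ℂ) • d)
      have t3 := vn_add (((1 - Real.cos τ : ℝ) : ℂ) • p) (((τ - Real.sin τ : ℝ) : ℂ) • d)
      rw [vn_smul, vn_smul, Complex.norm_real, Complex.norm_real, Real.norm_eq_abs,
        Real.norm_eq_abs, abs_sub_comm, abs_sub_comm τ] at t3
      have t4 := vn_mulVec X (M.mulVec ψ - p)
      have t5 : ‖X‖ * vn (M.mulVec ψ - p) ≤ 1 * (s * (16 * τ ^ 2 * K ^ 2)) :=
        mul_le_mul hRX.uni.norm_le hM (vn_nonneg _) zero_le_one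
      have t6 := vn_mulVec (X - 1 - (Complex.I * (τ : ℂ)) • G) p
      have t7 := mul_le_mul hX2 hp2 (vn_nonneg _) (by positivity)
      have t8 := mul_le_mul (cos_err τ) hp2 (vn_nonneg _) (by positivity)
      have t9 := mul_le_mul (sin_err τ) hd2 (vn_nonneg _) (by positivity)
      have t10 : τ ^ 2 * 1 ≤ τ ^ 2 * K ^ 2 := by gcongr; nlinarith
      have t11 : ((s + 1 : ℕ) : ℝ) = s + 1 := by push_cast; rfl
      rw [mul_pow] at t7
      rw [t11]
      linarith

lemma energy_pert {n : ℕ} (H : Mt n) (hH : H.PosSemidef) (hH1 : (1 - H).PosSemidef)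
    (p e : (Fin n → Fin 2) → ℂ) (hp : vn p = 1) (he : vn e ≤ 1) :
    Bf H (p + e) (p + e) ≤ Bf H p p + 3 * vn e := by
  have hpos : ∀ v, 0 ≤ Bf H v v := fun v => hH.re_dotProduct_nonneg v
  have hle : ∀ v, Bf H v v ≤ vn v ^ 2 := by
    intro v
    have h := hH1.re_dotProduct_nonneg v
    rw [Matrix.sub_mulVec, Matrix.one_mulVec, dotProduct_sub, map_sub, ← ip_eq, ip_self] at h
    have h2 : RCLike.re (star v ⬝ᵥ H.mulVec v) = Bf H v v := rfl
    have h3 : RCLike.re ((vn v ^ 2 : ℝ) : ℂ) = vn v ^ 2 := Complex.ofReal_re _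
    rw [h2, h3] at h
    linarith
  have h1 := Bf_comb H hH.1 p e 1 1
  have h2 := hpos (((vn e : ℝ) : ℂ) • p + ((-1 : ℝ) : ℂ) • e)
  rw [Bf_comb H hH.1 p e (vn e) (-1)] at h2
  simp only [Complex.ofReal_one, one_smul] at h1
  rw [h1]
  have h3 := hle p
  have h4 := hle e
  rw [hp] at h3
  have h0 := vn_nonneg e
  rcases h0.eq_or_lt with h | h
  · have : e = 0 := vn_eq_zero e h.symm
    subst this
    have : Bf H p 0 = 0 := by simp [Bf, ip]
    have : Bf H 0 0 = 0 := by simp [Bf, ip]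
    nlinarith
  · have : Bf H p e ≤ vn e := by
      by_contra hc
      push Not at hc
      nlinarith [mul_lt_mul_of_pos_left hc h, mul_le_mul_of_nonneg_left h3 (sq_nonneg (vn e))]
    nlinarith

/-! ### The path -/

lemma exists_phase {n : ℕ} (H : Mt n) (η : ℝ) (ψ φ : (Fin n → Fin 2) → ℂ) :
    ∃ (u : ℂ) (s : ℝ), ‖u‖ = 1 ∧ ip ψ (u • φ) = (s : ℂ) ∧ Bf H ψ (u • φ) ≤ η * s := by
  have hu0 : ∃ u0 : ℂ, ‖u0‖ = 1 ∧ u0 * ip ψ φ = ((‖ip ψ φ‖ : ℝ) : ℂ) := by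
    by_cases hz : ip ψ φ = 0
    · exact ⟨1, by simp, by simp [hz]⟩
    · have h0 : (‖ip ψ φ‖ : ℂ) ≠ 0 := by exact_mod_cast norm_ne_zero_iff.2 hz
      refine ⟨star (ip ψ φ) / (‖ip ψ φ‖ : ℂ), ?_, ?_⟩
      · rw [norm_div, norm_star, Complex.norm_real, norm_norm, div_self (norm_ne_zero_iff.2 hz)]
      · have := Complex.conj_mul' (ip ψ φ)
        rw [div_mul_eq_mul_div]
        rw [div_eq_iff h0, ← sq]; exact this
  obtain ⟨u0, h1, h2⟩ := hu0
  have hip : ∀ u : ℂ, ip ψ (u • φ) = u * ip ψ φ := by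
    intro u; rw [ip_eq, ip_eq, dotProduct_smul, smul_eq_mul]
  have hB : Bf H ψ ((-u0) • φ) = - Bf H ψ (u0 • φ) := by
    unfold Bf
    rw [ip_eq, ip_eq, neg_smul, Matrix.mulVec_neg, dotProduct_neg, Complex.neg_re]
  by_cases hc : Bf H ψ (u0 • φ) ≤ η * ‖ip ψ φ‖
  · exact ⟨u0, _, h1, by rw [hip, h2], hc⟩
  · refine ⟨-u0, -‖ip ψ φ‖, by rw [norm_neg, h1], ?_, ?_⟩
    · rw [hip, neg_mul, h2]; push_cast; rfl
    · rw [hB]; push Not at hc; linarith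

lemma count_bound (n N m : ℕ) (hn : 1 ≤ n) (Δ S K : ℝ) (hΔ : 0 < Δ) (hΔ1 : Δ ≤ 1) (hS0 : 0 ≤ S)
    (hS : S ≤ 64 * n / Δ) (hK : K = 2 * 8 ^ n * S ^ (n - 1))
    (hN : (N : ℝ) ≤ 4096 * K ^ 2 / Δ + 1) (hm : m ≤ N * (4 ^ n * (5 * 2 ^ n)) + 1) :
    (m : ℝ) ≤ (1000000 * (n : ℝ) ^ 2 * ((2 : ℝ) ^ n) ^ 2 / Δ) ^ (2 * n) := by
  have hn1 : (1 : ℝ) ≤ n := by exact_mod_cast hn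
  set T : ℝ := 64 * n / Δ with hT
  have hT1 : 1 / Δ ≤ T := by rw [hT]; gcongr; linarith
  have hΔi : 1 ≤ 1 / Δ := by rw [le_div_iff₀ hΔ]; linarith
  have hT2 : 1 ≤ T := hΔi.trans hT1
  have hm' : (m : ℝ) ≤ N * (5 * 8 ^ n) + 1 := by
    have : (m : ℝ) ≤ N * (4 ^ n * (5 * 2 ^ n)) + 1 := by exact_mod_cast hm
    rw [show (8 : ℝ) = 4 * 2 by norm_num, mul_pow]; linarith
  have h8 : (1 : ℝ) ≤ 8 ^ n := one_le_pow₀ (by norm_num)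
  have hKT : K ^ 2 / Δ ≤ 4 * 64 ^ n * T ^ (2 * n) := by
    have e1 : K ^ 2 = 4 * 64 ^ n * S ^ (2 * (n - 1)) := by
      rw [hK, show (64 : ℝ) = 8 ^ 2 by norm_num, ← pow_mul, mul_comm 2 n, pow_mul]
      ring
    have e2 : S ^ (2 * (n - 1)) ≤ T ^ (2 * (n - 1)) := pow_le_pow_left₀ hS0 hS _
    have e3 : T ^ (2 * n) = T ^ (2 * (n - 1)) * (T * T) := by
      rw [← sq, ← pow_add]; congr 1; omega
    rw [e1, e3, div_eq_mul_one_div]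
    have e4 : 1 / Δ ≤ T * T := by nlinarith
    calc 4 * 64 ^ n * S ^ (2 * (n - 1)) * (1 / Δ)
        ≤ 4 * 64 ^ n * T ^ (2 * (n - 1)) * (T * T) := by gcongr
      _ = _ := by ring
  have hbig : (1 : ℝ) ≤ 64 ^ n * T ^ (2 * n) :=
    one_le_mul_of_one_le_of_one_le (one_le_pow₀ (by norm_num)) (one_le_pow₀ hT2)
  have h1 : (N : ℝ) ≤ 16385 * (64 ^ n * T ^ (2 * n)) := by
    have : 4096 * K ^ 2 / Δ = 4096 * (K ^ 2 / Δ) := by ring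
    nlinarith
  have h2 : (m : ℝ) ≤ 90000 * ((64 ^ n * T ^ (2 * n)) * 8 ^ n) := by
    have h3 : (N : ℝ) * (5 * 8 ^ n) ≤ 16385 * (64 ^ n * T ^ (2 * n)) * (5 * 8 ^ n) := by gcongr
    have h4 := one_le_mul_of_one_le_of_one_le hbig h8
    linarith
  have h5 : (90000 : ℝ) * ((64 ^ n * T ^ (2 * n)) * 8 ^ n) ≤ (300 * 24 * T) ^ (2 * n) := by
    have a1 : (90000 : ℝ) ≤ 300 ^ (2 * n) := by
      calc (90000 : ℝ) = 300 ^ 2 := by norm_num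
        _ ≤ 300 ^ (2 * n) := pow_le_pow_right₀ (by norm_num) (by omega)
    have a2 : (64 : ℝ) ^ n * 8 ^ n ≤ 24 ^ (2 * n) := by
      rw [← mul_pow, pow_mul]; exact pow_le_pow_left₀ (by norm_num) (by norm_num) _
    calc (90000 : ℝ) * ((64 ^ n * T ^ (2 * n)) * 8 ^ n)
        = 90000 * (64 ^ n * 8 ^ n) * T ^ (2 * n) := by ring
      _ ≤ 300 ^ (2 * n) * 24 ^ (2 * n) * T ^ (2 * n) := by gcongr
      _ = _ := by rw [mul_pow, mul_pow]
  refine (h2.trans h5).trans ?_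
  refine pow_le_pow_left₀ (by positivity) ?_ _
  rw [hT, ← mul_div_assoc]
  refine div_le_div_of_nonneg_right ?_ hΔ.le
  have h6 : (1 : ℝ) ≤ (2 ^ n) ^ 2 := one_le_pow₀ (one_le_pow₀ (by norm_num))
  have h7 : (n : ℝ) ^ 2 * 1 ≤ (n : ℝ) ^ 2 * (2 ^ n) ^ 2 :=
    mul_le_mul_of_nonneg_left h6 (sq_nonneg _)
  have h8 : (n : ℝ) ≤ (n : ℝ) ^ 2 := by nlinarith only [hn1]
  have h9 : (0 : ℝ) ≤ n := by linarith
  linarith only [h7, h8, h9]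

lemma arith_b1 (θ K N Δ : ℝ) (h0 : 0 ≤ θ) (h4 : θ ≤ 4) (h : 4096 * K ^ 2 ≤ N * Δ) :
    16 * θ ^ 2 * K ^ 2 ≤ Δ / 16 * N := by
  have h1 : θ ^ 2 ≤ 16 := by nlinarith
  have := mul_le_mul_of_nonneg_right h1 (sq_nonneg K)
  linarith

lemma arith_b2 (θ K N Δ : ℝ) (h4 : θ ≤ 4) (hK : 1 ≤ K) (h : 4096 * K ^ 2 ≤ N * Δ) :
    2 * θ * K ≤ Δ / 16 * N := by
  have h1 : θ * K ≤ 4 * K := mul_le_mul_of_nonneg_right h4 (by linarith)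
  have h2 : K ≤ K ^ 2 := by nlinarith
  linarith

set_option maxHeartbeats 2000000 in
lemma core {n : ℕ} (hn : 1 ≤ n) (H : Mt n) (η : ℝ) (hH : H.PosSemidef)
    (hH1 : (1 - H).PosSemidef) (ψ φ : (Fin n → Fin 2) → ℂ) (hψ : vn ψ = 1)
    (hφ : vn φ = 1) (h1 : Bf H ψ ψ ≤ η) (h2 : Bf H φ φ ≤ η) (s : ℝ) (hs : ip ψ φ = (s : ℂ))
    (hs1 : s ^ 2 < 1) (h12 : Bf H ψ φ ≤ η * s) (Δ : ℝ) (hΔ : 0 < Δ) (hΔ1 : Δ ≤ 1) :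
    ∃ (m : ℕ) (M : Mt n),
      (((m + 1 : ℕ) : ℝ) ≤ (1000000 * (n : ℝ) ^ 2 * ((2 : ℝ) ^ n) ^ 2 / Δ) ^ (2 * n)) ∧
      RM (fun X => Bf H (X.mulVec ψ) (X.mulVec ψ) ≤ η + Δ) m M ∧ vn (M.mulVec ψ - φ) ≤ Δ := by
  have hn1 : (1 : ℝ) ≤ n := by exact_mod_cast hn
  -- geometry
  have hsl : -1 < s := by nlinarith
  have hsu : s < 1 := by nlinarith
  set θ := Real.arccos s with hθ
  set w := Real.sqrt (1 - s ^ 2) with hw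
  have hw0 : 0 < w := Real.sqrt_pos.2 (by linarith)
  have hw2 : w ^ 2 = 1 - s ^ 2 := Real.sq_sqrt (by linarith)
  have hcos : Real.cos θ = s := Real.cos_arccos hsl.le hsu.le
  have hsin : Real.sin θ = w := Real.sin_arccos s
  have hθ0 : 0 ≤ θ := Real.arccos_nonneg s
  have hθπ : θ ≤ Real.pi := Real.arccos_le_pi s
  have hwc : (w : ℂ) ≠ 0 := by exact_mod_cast hw0.ne'
  set q : (Fin n → Fin 2) → ℂ := ((w⁻¹ : ℝ) : ℂ) • φ + ((-(s * w⁻¹) : ℝ) : ℂ) • ψ with hq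
  have ipψ : ip ψ ψ = 1 := by rw [ip_self, hψ]; simp
  have ipφ : ip φ φ = 1 := by rw [ip_self, hφ]; simp
  have hs' : ip φ ψ = (s : ℂ) := by rw [ip_conj ψ φ, hs]; exact Complex.conj_ofReal s
  have ipψq : ip ψ q = 0 := by
    rw [hq, ip_eq, dotProduct_add, dotProduct_smul, dotProduct_smul, ← ip_eq, ← ip_eq, hs, ipψ]
    simp only [smul_eq_mul]; push_cast; ring
  have ipqψ : ip q ψ = 0 := by rw [ip_conj ψ q, ipψq]; simp
  have ipqφ : ip φ q = (w : ℂ) := by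
    rw [hq, ip_eq, dotProduct_add, dotProduct_smul, dotProduct_smul, ← ip_eq, ← ip_eq, hs', ipφ]
    simp only [smul_eq_mul]
    have : (w : ℂ) ^ 2 = 1 - s ^ 2 := by exact_mod_cast hw2
    push_cast; field_simp; rw [this]; ring
  have ipφq : ip q φ = (w : ℂ) := by rw [ip_conj φ q, ipqφ]; exact Complex.conj_ofReal w
  have ipq : ip q q = 1 := by
    have : ip q q = ((w⁻¹ : ℝ) : ℂ) * ip q φ + ((-(s * w⁻¹) : ℝ) : ℂ) * ip q ψ := by
      conv_lhs => rw [ip_eq]; arg 2; rw [hq]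
      rw [dotProduct_add, dotProduct_smul, dotProduct_smul]; rfl
    rw [this, ipφq, ipqψ]; push_cast; field_simp; simp
  have hqn : vn q = 1 := by
    have h := ip_self q
    rw [ipq] at h
    have h' : vn q ^ 2 = 1 := by exact_mod_cast h.symm
    nlinarith [vn_nonneg q]
  have hφq : φ = ((Real.cos θ : ℝ) : ℂ) • ψ + ((Real.sin θ : ℝ) : ℂ) • q := by
    rw [hcos, hsin, hq, smul_add, smul_smul, smul_smul]
    have e1 : (w : ℂ) * ((w⁻¹ : ℝ) : ℂ) = 1 := by push_cast; exact mul_inv_cancel₀ hwc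
    have e2 : (w : ℂ) * ((-(s * w⁻¹) : ℝ) : ℂ) = -s := by push_cast; field_simp
    rw [e1, e2]; module
  have pathn : ∀ t : ℝ, vn (((Real.cos t : ℝ) : ℂ) • ψ + ((Real.sin t : ℝ) : ℂ) • q) = 1 := by
    intro t
    have h := Bf_comb (1 : Mt n) Matrix.isHermitian_one ψ q (Real.cos t) (Real.sin t)
    simp only [Bf, Matrix.one_mulVec] at h
    rw [ip_self, ipψ, ipq, ipψq, Complex.ofReal_re] at h
    simp only [Complex.one_re, Complex.zero_re] at h
    have := Real.cos_sq_add_sin_sq t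
    nlinarith [vn_nonneg (((Real.cos t : ℝ) : ℂ) • ψ + ((Real.sin t : ℝ) : ℂ) • q)]
  have pathE : ∀ t : ℝ, 0 ≤ t → t ≤ θ →
      Bf H (((Real.cos t : ℝ) : ℂ) • ψ + ((Real.sin t : ℝ) : ℂ) • q)
        (((Real.cos t : ℝ) : ℂ) • ψ + ((Real.sin t : ℝ) : ℂ) • q) ≤ η := by
    intro t ht0 ht1
    set β := Real.sin t * w⁻¹ with hβ
    set α := Real.cos t - s * β with hα
    have e : ((Real.cos t : ℝ) : ℂ) • ψ + ((Real.sin t : ℝ) : ℂ) • q = (α : ℂ) • ψ + (β : ℂ) • φ := by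
      rw [hα, hβ, hq]; push_cast; module
    have hβ0 : 0 ≤ β := mul_nonneg (Real.sin_nonneg_of_nonneg_of_le_pi ht0 (by linarith))
      (by positivity)
    have hβw : β * w = Real.sin t := by rw [hβ]; field_simp
    have hα0 : 0 ≤ α := by
      have : α * w = Real.sin (θ - t) := by
        rw [Real.sin_sub, hcos, hsin, hα, sub_mul, mul_assoc, hβw]; ring
      have h3 : 0 ≤ α * w := by
        rw [this]; exact Real.sin_nonneg_of_nonneg_of_le_pi (by linarith) (by linarith)
      exact nonneg_of_mul_nonneg_left h3 hw0
    rw [e, Bf_comb H hH.1]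
    have hone : α ^ 2 + β ^ 2 + 2 * α * β * s = 1 := by
      have c1 : α + s * β = Real.cos t := by rw [hα]; ring
      have c2 := Real.cos_sq_add_sin_sq t
      rw [← c1, ← hβw, mul_pow, hw2] at c2
      linarith
    have k1 := mul_le_mul_of_nonneg_left h1 (sq_nonneg α)
    have k2 := mul_le_mul_of_nonneg_left h2 (sq_nonneg β)
    have k3 := mul_le_mul_of_nonneg_left h12 (by positivity : 0 ≤ 2 * α * β)
    calc _ ≤ α ^ 2 * η + β ^ 2 * η + 2 * α * β * (η * s) := by linarith
      _ = η * (α ^ 2 + β ^ 2 + 2 * α * β * s) := by ring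
      _ = η := by rw [hone, mul_one]
  -- the generator
  set A : Mt n := Matrix.vecMulVec q (star ψ) - Matrix.vecMulVec ψ (star q) with hA
  set G : Mt n := (-Complex.I) • A with hG
  have hIG : Complex.I • G = A := by rw [hG, smul_smul]; simp
  have hAs : Aᴴ = -A := by
    rw [hA, Matrix.conjTranspose_sub, Matrix.conjTranspose_vecMulVec,
      Matrix.conjTranspose_vecMulVec, star_star, star_star]; abel
  have hGs : Gᴴ = G := by
    rw [hG, Matrix.conjTranspose_smul, hAs]; simp
  have hGn : ∀ x y, ‖G x y‖ ≤ 2 := by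
    intro x y
    rw [hG, Matrix.smul_apply, norm_smul, norm_neg, Complex.norm_I, one_mul, hA,
      Matrix.sub_apply, Matrix.vecMulVec_apply, Matrix.vecMulVec_apply]
    refine (norm_sub_le _ _).trans ?_
    rw [norm_mul, norm_mul, Pi.star_apply, Pi.star_apply, norm_star, norm_star]
    have a1 := vn_entry ψ x
    have a2 := vn_entry ψ y
    have a3 := vn_entry q x
    have a4 := vn_entry q y
    rw [hψ] at a1 a2
    rw [hqn] at a3 a4
    have := mul_le_mul a3 a2 (norm_nonneg _) zero_le_one
    have := mul_le_mul a1 a4 (norm_nonneg _) zero_le_one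
    linarith
  have hvm : ∀ a b v : (Fin n → Fin 2) → ℂ, (Matrix.vecMulVec a (star b)).mulVec v = ip b v • a := by
    intro a b v
    ext x
    simp only [Matrix.mulVec, dotProduct, Matrix.vecMulVec_apply, ip, Pi.smul_apply, smul_eq_mul,
      Finset.sum_mul]
    refine Finset.sum_congr rfl fun y _ => ?_
    simp only [Pi.star_apply]
    have : star (b y) = (starRingEnd ℂ) (b y) := rfl
    rw [this]; ring
  have hGψ : (Complex.I • G).mulVec ψ = q := by
    rw [hIG, hA, Matrix.sub_mulVec, hvm, hvm, ipψ, ipqψ]; simp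
  have hGq : (Complex.I • G).mulVec q = -ψ := by
    rw [hIG, hA, Matrix.sub_mulVec, hvm, hvm, ipq, ipψq]; simp
  -- parameters
  set b : ℝ := Δ / (64 * n) with hb
  have hb0 : 0 < b := by positivity
  have hb1 : b ≤ 1 / 64 := by
    rw [hb, div_le_div_iff₀ (by positivity) (by norm_num)]; nlinarith
  have hsb : b ≤ Real.sin (2 * b) := by
    have h := Real.mul_le_sin (x := 2 * b) (by linarith) (by linarith [Real.pi_gt_three])
    have h3 : b ≤ 2 / Real.pi * (2 * b) := by
      rw [div_mul_eq_mul_div, le_div_iff₀ Real.pi_pos]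
      nlinarith [Real.pi_le_four]
    linarith
  have hs0 : 0 < Real.sin (2 * b) := lt_of_lt_of_le hb0 hsb
  set S := (Real.sin (2 * b))⁻¹ with hS
  have hS1 : 1 ≤ S := (one_le_inv₀ hs0).2 (Real.sin_le_one _)
  have hSu : S ≤ 64 * n / Δ := by
    have : S ≤ b⁻¹ := inv_anti₀ hb0 hsb
    rwa [hb, inv_div] at this
  set K : ℝ := 2 * 8 ^ n * S ^ (n - 1) with hK
  have hK1 : 1 ≤ K := by
    have a1 : (1 : ℝ) ≤ 8 ^ n := one_le_pow₀ (by norm_num)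
    have a2 : (1 : ℝ) ≤ S ^ (n - 1) := one_le_pow₀ hS1
    have := one_le_mul_of_one_le_of_one_le a1 a2
    rw [hK]; linarith
  have good := good_herm hn b hb0.le hs0 G hGs hGn
  set N : ℕ := ⌈4096 * K ^ 2 / Δ⌉₊ with hN
  have hNl : 4096 * K ^ 2 / Δ ≤ N := Nat.le_ceil _
  have hNu : (N : ℝ) ≤ 4096 * K ^ 2 / Δ + 1 := (Nat.ceil_lt_add_one (by positivity)).le
  have hNpos : (0 : ℝ) < N := lt_of_lt_of_le (by positivity) hNl
  set τ := θ / N with hτ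
  have hτ0 : 0 ≤ τ := by positivity
  have hτN : N * τ = θ := by rw [hτ]; field_simp
  have hθ4 : θ ≤ 4 := hθπ.trans Real.pi_le_four
  rw [div_le_iff₀ hΔ] at hNl
  have b1 : N * (16 * τ ^ 2 * K ^ 2) ≤ Δ / 16 := by
    have e : N * (16 * τ ^ 2 * K ^ 2) = 16 * θ ^ 2 * K ^ 2 / N := by rw [hτ]; field_simp
    rw [e, div_le_iff₀ hNpos]
    exact arith_b1 θ K N Δ hθ0 hθ4 hNl
  have b2 : 2 * τ * K ≤ Δ / 16 := by
    have e : 2 * τ * K = 2 * θ * K / N := by rw [hτ]; field_simp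
    rw [e, div_le_iff₀ hNpos]
    exact arith_b2 θ K N Δ hθ4 hK1 hNl
  have b3 : 4 * b * n = Δ / 16 := by rw [hb]; field_simp; norm_num
  obtain ⟨m, hm, M, hR, hM⟩ := walk ψ q G _ _ K τ good hK1 hτ0 hψ hqn hGψ hGq N
    (fun v => Bf H v v ≤ η + Δ) (by
      intro s hs e he
      have he' : vn e ≤ 3 * Δ / 16 := by linarith
      have hsN : (s : ℝ) ≤ N := by exact_mod_cast hs
      have hst : s * τ ≤ θ := by rw [← hτN]; gcongr
      have p1 := energy_pert H hH hH1 _ e (pathn (s * τ)) (by linarith)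
      have p2 := pathE (s * τ) (by positivity) hst
      linarith) N le_rfl
  refine ⟨m, M, ?_, hR, ?_⟩
  · exact count_bound n N (m + 1) hn Δ S K hΔ hΔ1 (by linarith) hSu hK hNu (by omega)
  · rw [hτN, ← hφq] at hM
    linarith

end GST

/-- **Ground space traversal** (Theorem `thm:traversal`). -/
theorem ground_space_traversal :
    ∃ C : ℝ, 0 < C ∧
      ∀ (n : ℕ), 1 ≤ n →
        ∀ (H : Matrix (Fin n → Fin 2) (Fin n → Fin 2) ℂ) (η : ℝ),
          H.IsHermitian → H.PosSemidef → ((1 : Matrix _ _ ℂ) - H).PosSemidef → 0 ≤ η →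
            ∀ ψ φ : (Fin n → Fin 2) → ℂ,
              _root_.enorm ψ = 1 → _root_.enorm φ = 1 →
              (ip ψ (H.mulVec ψ)).re ≤ η → (ip φ (H.mulVec φ)).re ≤ η →
                ∀ Δ : ℝ, 0 < Δ → Δ ≤ 1 →
                  ∃ (m : ℕ) (U : ℕ → Matrix (Fin n → Fin 2) (Fin n → Fin 2) ℂ),
                    (m : ℝ) ≤ (C * (n : ℝ) ^ 2 * ((2 : ℝ) ^ n) ^ 2 / Δ) ^ (2 * n) ∧
                    (∀ i, i < m → IsTwoLocalUnitary (U i)) ∧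
                    _root_.enorm (seqApply U ψ m - φ) ≤ Δ ∧
                    ∀ i, 1 ≤ i → i ≤ m →
                      (ip (seqApply U ψ i) (H.mulVec (seqApply U ψ i))).re ≤ η + Δ := by
  refine ⟨1000000, by norm_num, ?_⟩
  intro n hn H η hHerm hH hH1 hη ψ φ hψ hφ h1 h2 Δ hΔ hΔ1
  rw [GST.vn_eq] at hψ hφ
  simp only [GST.vn_eq]
  obtain ⟨u, s, hu, hs, hB⟩ := GST.exists_phase H η ψ φ
  have hu' : ‖u⁻¹‖ = 1 := by rw [norm_inv, hu, inv_one]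
  have hu0 : u ≠ 0 := by intro h; rw [h] at hu; simp at hu
  have huφ : GST.vn (u • φ) = 1 := by rw [GST.vn_smul, hu, hφ, one_mul]
  suffices hh : ∃ (m : ℕ) (M : GST.Mt n),
      ((m : ℝ) ≤ (1000000 * (n : ℝ) ^ 2 * ((2 : ℝ) ^ n) ^ 2 / Δ) ^ (2 * n)) ∧
      GST.RM (fun X => GST.Bf H (X.mulVec ψ) (X.mulVec ψ) ≤ η + Δ) m M ∧
        GST.vn (M.mulVec ψ - φ) ≤ Δ by
    obtain ⟨m, M, hm, hR, hM⟩ := hh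
    obtain ⟨U, hU1, hU2, hU3⟩ := hR.seq ψ
    refine ⟨m, U, hm, hU1, by rw [hU2]; exact hM, ?_⟩
    intro i hi1 hi2
    obtain ⟨X, hX1, hX2⟩ := hU3 i hi1 hi2
    rw [hX2]; exact hX1
  -- the vector orthogonal to the start
  have hnorm := GST.Bf_comb (1 : GST.Mt n) Matrix.isHermitian_one (u • φ) ψ 1 (-s)
  simp only [GST.Bf, Matrix.one_mulVec] at hnorm
  rw [GST.ip_self, GST.ip_self, GST.ip_self, GST.ip_conj ψ (u • φ), hs, huφ, hψ] at hnorm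
  have hstar : (star (s : ℂ)).re = s := by simp
  rw [hstar, Complex.ofReal_re, Complex.ofReal_re] at hnorm
  have hle : s ^ 2 ≤ 1 := by
    nlinarith [sq_nonneg (GST.vn (((1 : ℝ) : ℂ) • u • φ + ((-s : ℝ) : ℂ) • ψ))]
  rcases hle.lt_or_eq with hlt | heq
  · have h2' : GST.Bf H (u • φ) (u • φ) ≤ η := by rw [GST.Bf_phase H φ u hu]; exact h2
    obtain ⟨m, M, hm, hR, hM⟩ :=
      GST.core hn H η hH hH1 ψ (u • φ) hψ huφ h1 h2' s hs hlt hB Δ hΔ hΔ1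
    have hsm : ∀ X : GST.Mt n, ((u⁻¹ • (1 : GST.Mt n)) * X).mulVec ψ = u⁻¹ • X.mulVec ψ := by
      intro X; rw [smul_mul_assoc, one_mul, Matrix.smul_mulVec]
    have hfin := hR.uni
    refine ⟨m + 1, (u⁻¹ • (1 : GST.Mt n)) * M, hm, ?_, ?_⟩
    · refine GST.RM.cons hR (GST.phase_local hn _ hu') ?_
      rw [hsm, GST.Bf_phase H _ _ hu']
      cases hR with
      | nil => rw [Matrix.one_mulVec]; exact (show GST.Bf H ψ ψ ≤ η from h1).trans (by linarith)
      | cons _ _ hp => exact hp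
    · have e : ((u⁻¹ • (1 : GST.Mt n)) * M).mulVec ψ - φ = u⁻¹ • (M.mulVec ψ - u • φ) := by
        rw [hsm, smul_sub, smul_smul, inv_mul_cancel₀ hu0, one_smul]
      rw [e, GST.vn_smul, hu', one_mul]; exact hM
  · have hz : GST.vn (((1 : ℝ) : ℂ) • u • φ + ((-s : ℝ) : ℂ) • ψ) = 0 := by
      have : GST.vn (((1 : ℝ) : ℂ) • u • φ + ((-s : ℝ) : ℂ) • ψ) ^ 2 = 0 := by
        rw [hnorm]; linarith
      exact pow_eq_zero_iff (two_ne_zero) |>.1 this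
    have hz' := GST.vn_eq_zero _ hz
    have hφψ : φ = (u⁻¹ * s) • ψ := by
      have : u • φ = (s : ℂ) • ψ := by
        have h3 : ((1 : ℝ) : ℂ) • u • φ + ((-s : ℝ) : ℂ) • ψ = u • φ - (s : ℂ) • ψ := by
          push_cast; module
        rw [h3] at hz'
        exact sub_eq_zero.1 hz'
      rw [← smul_smul, ← this, smul_smul, inv_mul_cancel₀ hu0, one_smul]
    have hsn : ‖u⁻¹ * (s : ℂ)‖ = 1 := by
      rw [norm_mul, hu', one_mul, Complex.norm_real, Real.norm_eq_abs]
      have h01 : s = 1 ∨ s = -1 := by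
        have h3 : (s - 1) * (s + 1) = 0 := by linarith
        rcases mul_eq_zero.1 h3 with h | h
        · left; linarith
        · right; linarith
      rcases h01 with h | h <;> simp [h]
    have hv : ((u⁻¹ * (s : ℂ)) • (1 : GST.Mt n)).mulVec ψ = φ := by
      rw [Matrix.smul_mulVec, Matrix.one_mulVec, ← hφψ]
    refine ⟨1, (u⁻¹ * (s : ℂ)) • (1 : GST.Mt n), ?_,
      GST.RM.single (GST.phase_local hn _ hsn) ?_, ?_⟩
    · rw [Nat.cast_one]
      apply one_le_pow₀
      rw [le_div_iff₀ hΔ]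
      have hn1 : (1 : ℝ) ≤ (n : ℝ) ^ 2 := one_le_pow₀ (by exact_mod_cast hn)
      have hn2 : (1 : ℝ) ≤ ((2 : ℝ) ^ n) ^ 2 := one_le_pow₀ (one_le_pow₀ (by norm_num))
      have := one_le_mul_of_one_le_of_one_le hn1 hn2
      nlinarith
    · rw [hv]; exact (show GST.Bf H φ φ ≤ η from h2).trans (by linarith)
    · rw [hv, sub_self]; simp [GST.vn]; linarith
end

section
/- Mapping between close vectors via 2-local gates (Lemma lem:map-close-vectors): There exists a universal constant C > 0 such that the following holds. Let n ≥ 1, d = 2^n, and let ψ, φ ∈ ℂ^d be unit vectors with ‖ψ − φ‖ ≤ ε < (π/16)^(2n). Then there exist m ∈ ℕ with m ≤ 2^(C·n) and 2-local unitaries U_1, …, U_m on (ℂ²)^{⊗n} such that (1) ‖φ − U_m⋯U_1 ψ‖ ≤ C·d²·ε², and (2) for all i ∈ {1,…,m}, ‖ψ − U_i⋯U_1 ψ‖ ≤ C·n²·d²·ε^(1/(2n)). -/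
open scoped ComplexOrder Matrix Matrix.Norms.L2Operator

abbrev QM (n : ℕ) := Matrix (Fin n → Fin 2) (Fin n → Fin 2) ℂ

/-- the gate `c + i s P` -/
noncomputable def gate {I : Type*} [DecidableEq I] (P : Matrix I I ℂ) (c s : ℝ) : Matrix I I ℂ :=
  (c : ℂ) • (1 : Matrix I I ℂ) + (Complex.I * s) • P

def HI {I : Type*} [Fintype I] [DecidableEq I] (P : Matrix I I ℂ) : Prop := Pᴴ = P ∧ P * P = 1

lemma HI.one {I : Type*} [Fintype I] [DecidableEq I] : HI (1 : Matrix I I ℂ) := by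
  simp [HI]

lemma norm_le_of_unit {I : Type*} [Fintype I] [DecidableEq I] {P : Matrix I I ℂ}
    (h : Pᴴ * P = 1) (h' : P * Pᴴ = 1) : ‖P‖ ≤ 1 := by
  have h1 : P ∈ unitary (Matrix I I ℂ) := by
    rw [Unitary.mem_iff, Matrix.star_eq_conjTranspose]; exact ⟨h, h'⟩
  rcases subsingleton_or_nontrivial (Matrix I I ℂ) with h2 | h2
  · rw [Subsingleton.elim P 0]; simp
  · exact (CStarRing.norm_of_mem_unitary h1).le

lemma HI.norm_le {I : Type*} [Fintype I] [DecidableEq I] {P : Matrix I I ℂ} (h : HI P) : ‖P‖ ≤ 1 :=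
  norm_le_of_unit (by rw [h.1, h.2]) (by rw [h.1, h.2])

lemma gate_conj {I : Type*} [Fintype I] [DecidableEq I] {P : Matrix I I ℂ} (h : HI P) (c s : ℝ) :
    (gate P c s)ᴴ = gate P c (-s) := by
  simp [gate, Matrix.conjTranspose_add, Matrix.conjTranspose_smul, h.1]

lemma gate_mul {I : Type*} [Fintype I] [DecidableEq I] {P : Matrix I I ℂ} (h : HI P) (c s c' s' : ℝ) :
    gate P c s * gate P c' s' = gate P (c * c' - s * s') (c * s' + s * c') := by
  simp only [gate, mul_add, add_mul, smul_mul_assoc, mul_smul_comm, one_mul, mul_one, h.2, smul_smul,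
    smul_add]
  push_cast
  match_scalars
  · ring_nf; simp; ring
  · ring

lemma gate_unit {I : Type*} [Fintype I] [DecidableEq I] {P : Matrix I I ℂ} (h : HI P) {c s : ℝ}
    (hc : c ^ 2 + s ^ 2 = 1) :
    (gate P c s)ᴴ * gate P c s = 1 ∧ gate P c s * (gate P c s)ᴴ = 1 := by
  rw [gate_conj h, gate_mul h, gate_mul h]
  have h1 : c * c - -s * s = 1 := by linarith
  have h2 : c * c - s * -s = 1 := by linarith
  rw [h1, h2]
  constructor <;> simp [gate] <;> ring_nf <;> simp

lemma gate_sub_one {I : Type*} [Fintype I] [DecidableEq I] {P : Matrix I I ℂ} (h : HI P) (c s : ℝ) :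
    ‖gate P c s - 1‖ ≤ |c - 1| + |s| := by
  have : gate P c s - 1 = ((c - 1 : ℝ) : ℂ) • (1 : Matrix I I ℂ) + (Complex.I * s) • P := by
    simp only [gate]; push_cast; module
  rw [this]
  refine (norm_add_le _ _).trans ?_
  rw [norm_smul, norm_smul]
  have h1 := h.norm_le
  have h2 := (HI.one (I := I)).norm_le
  simp only [Complex.norm_real, norm_mul, Complex.norm_I, one_mul, Real.norm_eq_abs]
  gcongr
  · exact mul_le_of_le_one_right (abs_nonneg _) h2
  · exact mul_le_of_le_one_right (abs_nonneg _) h1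

lemma one_sub_le {c s : ℝ} (hc0 : 0 ≤ c) (hc : c ^ 2 + s ^ 2 = 1) : |c - 1| ≤ s ^ 2 ∧ s ^ 2 ≤ |s| := by
  have : c ≤ 1 := by nlinarith [sq_nonneg s]
  have h1 : |s| ≤ 1 := by
    rw [abs_le]; constructor <;> nlinarith [sq_nonneg c]
  constructor
  · rw [abs_sub_comm, abs_of_nonneg (by linarith)]; nlinarith
  · rw [← sq_abs]; nlinarith [abs_nonneg s]

lemma gate_sub_one' {I : Type*} [Fintype I] [DecidableEq I] {P : Matrix I I ℂ} (h : HI P) {c s : ℝ}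
    (hc0 : 0 ≤ c) (hc : c ^ 2 + s ^ 2 = 1) :
    ‖gate P c s - 1‖ ≤ 2 * |s| := by
  have := gate_sub_one h c s
  have := one_sub_le hc0 hc
  linarith

lemma gate_first {I : Type*} [Fintype I] [DecidableEq I] (P : Matrix I I ℂ) {c s : ℝ}
    (hc0 : 0 ≤ c) (hc : c ^ 2 + s ^ 2 = 1) :
    ‖gate P c s - 1 - (Complex.I * s) • P‖ ≤ s ^ 2 := by
  have : gate P c s - 1 - (Complex.I * s) • P = ((c - 1 : ℝ) : ℂ) • (1 : Matrix I I ℂ) := by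
    simp only [gate]; push_cast; module
  rw [this, norm_smul, Complex.norm_real, Real.norm_eq_abs]
  exact (mul_le_of_le_one_right (abs_nonneg _) (HI.one (I := I)).norm_le).trans (one_sub_le hc0 hc).1

/-- tensor product -/
def tens {n : ℕ} (f : Fin n → Matrix (Fin 2) (Fin 2) ℂ) : QM n :=
  fun x y => ∏ k, f k (x k) (y k)

lemma tens_mul {n : ℕ} (f g : Fin n → Matrix (Fin 2) (Fin 2) ℂ) :
    tens f * tens g = tens (fun k => f k * g k) := by
  ext x y
  simp only [Matrix.mul_apply, tens, ← Finset.prod_mul_distrib]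
  rw [Finset.prod_univ_sum]
  simp

lemma tens_one {n : ℕ} : tens (fun _ : Fin n => 1) = 1 := by
  ext x y
  simp only [tens, Matrix.one_apply, funext_iff]
  rw [Finset.prod_ite_zero]
  simp

lemma tens_conj {n : ℕ} (f : Fin n → Matrix (Fin 2) (Fin 2) ℂ) :
    (tens f)ᴴ = tens (fun k => (f k)ᴴ) := by
  ext x y
  simp [tens, Matrix.conjTranspose_apply]

lemma HI.tens {n : ℕ} {f : Fin n → Matrix (Fin 2) (Fin 2) ℂ} (h : ∀ k, HI (f k)) : HI (tens f) := by
  constructor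
  · rw [tens_conj]; congr 1; ext1 k; exact (h k).1
  · rw [tens_mul, ← tens_one]; congr 1; ext1 k; exact (h k).2

lemma tens_smul {n : ℕ} (f g : Fin n → Matrix (Fin 2) (Fin 2) ℂ) (i : Fin n) (c : ℂ)
    (hi : f i = c • g i) (h : ∀ k, k ≠ i → f k = g k) : tens f = c • tens g := by
  ext x y
  simp only [tens, Matrix.smul_apply, smul_eq_mul]
  rw [← Finset.mul_prod_erase _ _ (Finset.mem_univ i), ← Finset.mul_prod_erase _ (fun k => g k (x k) (y k)) (Finset.mem_univ i), hi]
  rw [Matrix.smul_apply, smul_eq_mul, mul_assoc]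
  congr 2
  apply Finset.prod_congr rfl
  intro k hk
  rw [h k (Finset.ne_of_mem_erase hk)]

lemma local_two {n : ℕ} {f : Fin n → Matrix (Fin 2) (Fin 2) ℂ} (hf : ∀ k, HI (f k)) {i j : Fin n}
    (hij : i ≠ j) (h : ∀ k, k ≠ i → k ≠ j → f k = 1) {c s : ℝ} (hc : c ^ 2 + s ^ 2 = 1) :
    IsTwoLocalUnitary (gate (tens f) c s) := by
  refine ⟨(gate_unit (HI.tens hf) hc).1, (gate_unit (HI.tens hf) hc).2, i, j,
    gate (Matrix.kroneckerMap (· * ·) (f i) (f j)) c s, ?_⟩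
  have hV : HI (Matrix.kroneckerMap (· * ·) (f i) (f j)) := by
    constructor
    · rw [Matrix.conjTranspose_kronecker, (hf i).1, (hf j).1]
    · rw [← Matrix.mul_kronecker_mul, (hf i).2, (hf j).2, Matrix.one_kronecker_one]
  refine ⟨(gate_unit hV hc).1, (gate_unit hV hc).2, fun x y => ?_⟩
  split_ifs with hk
  · have e1 : tens f x y = f i (x i) (y i) * f j (x j) (y j) := by
      unfold tens
      rw [← Finset.prod_subset (Finset.subset_univ {i, j}), Finset.prod_pair hij]
      intro k _ hk'
      simp only [Finset.mem_insert, Finset.mem_singleton, not_or] at hk'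
      rw [h k hk'.1 hk'.2, hk k hk'.1 hk'.2, Matrix.one_apply_eq]
    have e2 : (x = y) ↔ (x i = y i ∧ x j = y j) := by
      constructor
      · rintro rfl; simp
      · rintro ⟨h1, h2⟩; ext1 k
        by_cases a : k = i
        · rw [a, h1]
        by_cases b : k = j
        · rw [b, h2]
        exact hk k a b
    simp [gate, Matrix.one_apply, e1, e2, Matrix.kroneckerMap_apply]
  · push Not at hk
    obtain ⟨k, k1, k2, k3⟩ := hk
    have e1 : tens f x y = 0 := by
      apply Finset.prod_eq_zero (Finset.mem_univ k)
      rw [h k k1 k2, Matrix.one_apply_ne k3]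
    have e2 : x ≠ y := fun h => k3 (by rw [h])
    simp [gate, e1, e2]

lemma local_one {n : ℕ} {f : Fin n → Matrix (Fin 2) (Fin 2) ℂ} (hf : ∀ k, HI (f k)) {i : Fin n}
    (h : ∀ k, k ≠ i → f k = 1) {c s : ℝ} (hc : c ^ 2 + s ^ 2 = 1) :
    IsTwoLocalUnitary (gate (tens f) c s) := by
  refine ⟨(gate_unit (HI.tens hf) hc).1, (gate_unit (HI.tens hf) hc).2, i, i,
    gate ((Matrix.kroneckerMap (· * ·) (f i) (1 : Matrix (Fin 2) (Fin 2) ℂ)).submatrix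
      (Equiv.prodShear (Equiv.refl (Fin 2)) (fun a => Equiv.addLeft (-a)))
      (Equiv.prodShear (Equiv.refl (Fin 2)) (fun a => Equiv.addLeft (-a)))) c s, ?_⟩
  have hV0 : HI (Matrix.kroneckerMap (· * ·) (f i) (1 : Matrix (Fin 2) (Fin 2) ℂ)) := by
    constructor
    · rw [Matrix.conjTranspose_kronecker, (hf i).1, Matrix.conjTranspose_one]
    · rw [← Matrix.mul_kronecker_mul, (hf i).2, one_mul, Matrix.one_kronecker_one]
  have hV : HI ((Matrix.kroneckerMap (· * ·) (f i) (1 : Matrix (Fin 2) (Fin 2) ℂ)).submatrix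
      (Equiv.prodShear (Equiv.refl (Fin 2)) (fun a => Equiv.addLeft (-a)))
      (Equiv.prodShear (Equiv.refl (Fin 2)) (fun a => Equiv.addLeft (-a)))) := by
    constructor
    · rw [Matrix.conjTranspose_submatrix, hV0.1]
    · rw [Matrix.submatrix_mul_equiv, hV0.2, Matrix.submatrix_one_equiv]
  refine ⟨(gate_unit hV hc).1, (gate_unit hV hc).2, fun x y => ?_⟩
  split_ifs with hk
  · have e1 : tens f x y = f i (x i) (y i) := by
      unfold tens
      rw [← Finset.prod_subset (Finset.subset_univ {i}), Finset.prod_singleton]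
      intro k _ hk'
      simp only [Finset.mem_singleton] at hk'
      rw [h k hk', hk k hk' hk', Matrix.one_apply_eq]
    have e2 : (x = y) ↔ (x i = y i) := by
      constructor
      · rintro rfl; simp
      · intro h1; ext1 k
        by_cases a : k = i
        · rw [a, h1]
        exact hk k a a
    simp [gate, Matrix.one_apply, e1, e2, Matrix.kroneckerMap_apply]
  · push Not at hk
    obtain ⟨k, k1, k2, k3⟩ := hk
    have e1 : tens f x y = 0 := by
      apply Finset.prod_eq_zero (Finset.mem_univ k)
      rw [h k k1, Matrix.one_apply_ne k3]
    have e2 : x ≠ y := fun h => k3 (by rw [h])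
    simp [gate, e1, e2]

def Reach {n : ℕ} (κ : ℝ) (N : ℕ) (W : QM n) : Prop :=
  ∃ L : List (QM n), L.length ≤ N ∧ (∀ M ∈ L, IsTwoLocalUnitary M ∧ ‖M - 1‖ ≤ κ) ∧ L.prod = W

lemma Reach.mul {n : ℕ} {κ : ℝ} {N N' : ℕ} {W W' : QM n} (h : Reach κ N W) (h' : Reach κ N' W') :
    Reach κ (N + N') (W * W') := by
  obtain ⟨L, a, b, c⟩ := h
  obtain ⟨L', a', b', c'⟩ := h'
  refine ⟨L ++ L', by simp; omega, ?_, by simp [c, c']⟩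
  intro M hM
  rcases List.mem_append.1 hM with h | h
  · exact b M h
  · exact b' M h

lemma Reach.mono {n : ℕ} {κ : ℝ} {N N' : ℕ} {W : QM n} (h : Reach κ N W) (h' : N ≤ N') :
    Reach κ N' W := by
  obtain ⟨L, a, b, c⟩ := h
  exact ⟨L, a.trans h', b, c⟩

lemma Reach.single {n : ℕ} {κ : ℝ} {W : QM n} (h : IsTwoLocalUnitary W) (h' : ‖W - 1‖ ≤ κ) :
    Reach κ 1 W := ⟨[W], by simp, by simp [h, h'], by simp⟩

lemma alg1 {I : Type*} [Fintype I] [DecidableEq I] {X Y Z : Matrix I I ℂ} (hX : X * X = 1)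
    (hY : Y * Y = 1) (hXY : X * Y = - (Y * X)) (hZ : Y * X = Complex.I • Z) (a1 a2 b1 b2 : ℝ)
    (ha : a1 ^ 2 + a2 ^ 2 = 1) :
    gate X a1 a2 * gate Y b1 b2 * gate X a1 (-a2) =
      (b1 : ℂ) • 1 + (Complex.I * b2 * (a1 ^ 2 - a2 ^ 2)) • Y + (Complex.I * (b2 * (2 * a1 * a2))) • Z := by
  have hXYX : X * Y * X = - Y := by rw [hXY, neg_mul, mul_assoc, hX, mul_one]
  simp only [gate, mul_add, add_mul, smul_mul_assoc, mul_smul_comm, one_mul, mul_one, smul_smul,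
    smul_add, hX, hXYX]
  rw [hXY, hZ]
  have ha' : (a1 : ℂ) ^ 2 = 1 - a2 ^ 2 := by
    rw [eq_sub_iff_add_eq]; exact_mod_cast ha
  match_scalars
  all_goals (push_cast; ring_nf; try simp only [Complex.I_sq, Complex.I_pow_three, ha']; try ring_nf)

lemma alg2 {I : Type*} [Fintype I] [DecidableEq I] {X Y Z : Matrix I I ℂ} (hX : X * X = 1)
    (hY : Y * Y = 1) (hXY : X * Y = - (Y * X)) (hZ : Y * X = Complex.I • Z) (b t e : ℂ) :
    (b • (1 : Matrix I I ℂ) + (Complex.I * t) • Y + (Complex.I * e) • Z) *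
    (b • (1 : Matrix I I ℂ) - (Complex.I * t) • Y + (Complex.I * e) • Z) =
      (b ^ 2 + t ^ 2 - e ^ 2) • 1 + (Complex.I * (2 * t * e)) • X + (Complex.I * (2 * b * e)) • Z := by
  have hZ' : Z = (-Complex.I) • (Y * X) := by rw [hZ, smul_smul]; simp
  have hYYX : Y * (Y * X) = X := by rw [← mul_assoc, hY, one_mul]
  have hYXY : Y * X * Y = - X := by rw [mul_assoc, hXY, mul_neg, hYYX]
  have hYXYX : Y * X * (Y * X) = - 1 := by rw [← mul_assoc, hYXY, neg_mul, hX]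
  rw [hZ']
  simp only [mul_add, add_mul, mul_sub, sub_mul, smul_mul_assoc, mul_smul_comm, one_mul, mul_one, smul_smul,
    smul_add, smul_sub, hX, hY, hYYX, hYXY, hYXYX]
  match_scalars
  all_goals (ring_nf; try simp only [Complex.I_sq, Complex.I_pow_three, Complex.I_pow_four]; try ring_nf)

lemma alg3 {I : Type*} [Fintype I] [DecidableEq I] {X Y Z : Matrix I I ℂ} (hX : X * X = 1)
    (hXY : X * Y = - (Y * X)) (hZ : Y * X = Complex.I • Z) (w1 w2 : ℝ)
    (hw : w1 ^ 2 + w2 ^ 2 = 1) (A C E : ℝ) (r : ℝ)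
    (hr : (⟨w1, w2⟩ : ℂ) ^ 2 * ⟨A, C⟩ = r) :
    gate X w1 w2 * ((A : ℂ) • (1 : Matrix I I ℂ) + (Complex.I * C) • X + (Complex.I * E) • Z) * gate X w1 w2
     = gate Z r E := by
  have hZ' : Z = (-Complex.I) • (Y * X) := by rw [hZ, smul_smul]; simp
  have hXX : X * (Y * X) = - Y := by rw [← mul_assoc, hXY, neg_mul, mul_assoc, hX, mul_one]
  have hYXX : Y * X * X = Y := by rw [mul_assoc, hX, mul_one]
  have h1 := congrArg Complex.re hr
  have h2 := congrArg Complex.im hr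
  simp [pow_two] at h1 h2
  have h1' : ((w1 * w1 - w2 * w2) * A - (w1 * w2 + w2 * w1) * C : ℂ) = r := by exact_mod_cast h1
  have h2' : ((w1 * w1 - w2 * w2) * C + (w1 * w2 + w2 * w1) * A : ℂ) = 0 := by exact_mod_cast h2
  have hw' : (w1 : ℂ) ^ 2 = 1 - w2 ^ 2 := by
    rw [eq_sub_iff_add_eq]; exact_mod_cast hw
  rw [hZ']
  simp only [gate, mul_add, add_mul, mul_sub, sub_mul, smul_mul_assoc, mul_smul_comm, one_mul, mul_one, smul_smul,
    smul_add, smul_sub, hX, hYXX, hXX, neg_mul, hXY]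
  rw [← h1']
  match_scalars
  · linear_combination (w2 * w2 * A + 2 * w1 * w2 * C) * Complex.I_sq
  · linear_combination Complex.I * h2' + (w2 * w2 * C * Complex.I) * Complex.I_sq
  · linear_combination E * hw' - E * w2^2 * Complex.I_sq + E * (1 - w1 ^ 2 + Complex.I ^ 2 * w2 ^ 2) * Complex.I_sq
  · ring

set_option maxHeartbeats 1000000 in
lemma step_scalar {p s c q : ℝ} (hp : 0 < p) (hp4 : p ≤ 1 / 4) (hq0 : 0 ≤ q) (hq : q ≤ p)
    (hc0 : 0 ≤ c) (hc : c ^ 2 + s ^ 2 = 1) (hs : |s| ≤ p * q) :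
    ∃ a1 b1 b2 w1 w2 : ℝ, 0 ≤ a1 ∧ a1 ^ 2 + p ^ 2 = 1 ∧ 0 ≤ b1 ∧ b1 ^ 2 + b2 ^ 2 = 1 ∧ |b2| ≤ q ∧
      w1 ^ 2 + w2 ^ 2 = 1 ∧ |w1 - 1| + |w2| ≤ 12 * p ∧
      2 * b1 * (b2 * (2 * a1 * p)) = s ∧
      (⟨w1, w2⟩ : ℂ) ^ 2 * ⟨b1 ^ 2 + (b2 * (a1 ^ 2 - p ^ 2)) ^ 2 - (b2 * (2 * a1 * p)) ^ 2,
        2 * (b2 * (a1 ^ 2 - p ^ 2)) * (b2 * (2 * a1 * p))⟩ = c := by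
  obtain ⟨a1, ha1⟩ : ∃ a1, a1 = √(1 - p ^ 2) := ⟨_, rfl⟩
  have ha0 : 0 ≤ a1 := by rw [ha1]; positivity
  have ha : a1 ^ 2 + p ^ 2 = 1 := by
    rw [ha1, Real.sq_sqrt (by nlinarith)]; ring
  have ha2 : 1 / 2 ≤ a1 := by nlinarith only [ha, ha0, hp, hp4]
  obtain ⟨x, hx⟩ : ∃ x, x = s / (2 * a1 * p) := ⟨_, rfl⟩
  have hxs : x * (2 * a1 * p) = s := by rw [hx]; field_simp
  have hxq : |x| ≤ q := by
    rw [hx, abs_div, abs_of_pos (by positivity : 0 < 2 * a1 * p), div_le_iff₀ (by positivity)]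
    have : 0 ≤ p * q := by positivity
    nlinarith only [this, hs, ha2]
  have hx1 : x ^ 2 ≤ 1 / 16 := by
    have := pow_le_pow_left₀ (abs_nonneg x) (hxq.trans (hq.trans hp4)) 2
    rw [sq_abs] at this; linarith
  obtain ⟨r, hr⟩ : ∃ r, r = √(1 - x ^ 2) := ⟨_, rfl⟩
  have hr0 : 0 ≤ r := by rw [hr]; positivity
  have hr2 : r ^ 2 = 1 - x ^ 2 := by rw [hr, Real.sq_sqrt (by linarith)]
  obtain ⟨b1, hb1⟩ : ∃ b1, b1 = √((1 + r) / 2) := ⟨_, rfl⟩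
  have hb0 : 0 ≤ b1 := by rw [hb1]; positivity
  have hb2 : b1 ^ 2 = (1 + r) / 2 := by rw [hb1, Real.sq_sqrt (by linarith)]
  have hbh : 1 / 2 ≤ b1 := by nlinarith only [hb2, hr0, hb0]
  obtain ⟨b2, hb⟩ : ∃ b2, b2 = x / (2 * b1) := ⟨_, rfl⟩
  have hbx : 2 * b1 * b2 = x := by rw [hb]; field_simp
  have hbb : b1 ^ 2 + b2 ^ 2 = 1 := by
    have : 4 * b1 ^ 2 * b2 ^ 2 = x ^ 2 := by rw [← hbx]; ring
    have h3 : (2 * (1 + r)) * b2 ^ 2 = (2 * (1 + r)) * ((1 - r) / 2) := by rw [hb2] at this; nlinarith only [this, hr2]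
    have h4 := mul_left_cancel₀ (by positivity) h3
    rw [h4, hb2]; ring
  have hb2q : |b2| ≤ q := by
    rw [hb, abs_div, abs_of_pos (by positivity : 0 < 2 * b1), div_le_iff₀ (by positivity)]
    nlinarith only [hxq, hbh, hq0]
  obtain ⟨t, ht⟩ : ∃ t, t = b2 * (a1 ^ 2 - p ^ 2) := ⟨_, rfl⟩
  obtain ⟨e, he⟩ : ∃ e, e = b2 * (2 * a1 * p) := ⟨_, rfl⟩
  have hes : 2 * b1 * e = s := by rw [he, ← hxs, ← hbx]; ring
  have hte : t ^ 2 + e ^ 2 = b2 ^ 2 := by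
    have : t ^ 2 + e ^ 2 = b2 ^ 2 * (a1 ^ 2 + p ^ 2) ^ 2 := by rw [ht, he]; ring
    rw [this, ha]; ring
  have hb2p : b2 ^ 2 ≤ p ^ 2 := by
    rw [← sq_abs]; exact pow_le_pow_left₀ (abs_nonneg _) (hb2q.trans hq) 2
  obtain ⟨D, hD⟩ : ∃ D : ℂ, D = ⟨b1 ^ 2 + t ^ 2 - e ^ 2, 2 * t * e⟩ := ⟨_, rfl⟩
  have hDn : ‖D‖ = c := by
    have : ‖D‖ ^ 2 = c ^ 2 := by
      rw [Complex.sq_norm, hD, Complex.normSq_mk]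
      have h1 : c ^ 2 = (b1 ^ 2 + (t ^ 2 + e ^ 2)) ^ 2 - (2 * b1 * e) ^ 2 := by
        rw [hte, hbb, hes]; linarith
      rw [h1]; ring
    exact (pow_left_inj₀ (norm_nonneg _) hc0 (by norm_num)).1 this
  have hsp : s ^ 2 ≤ p ^ 2 := by
    rw [← sq_abs]
    have : |s| ≤ p := hs.trans (mul_le_of_le_one_right hp.le (by linarith))
    exact pow_le_pow_left₀ (abs_nonneg _) this 2
  have hc2 : 1 / 2 ≤ c := by nlinarith only [hc, hc0, hsp, hp, hp4]
  have hD0 : D ≠ 0 := by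
    intro h; rw [h] at hDn; simp at hDn; linarith
  have hD1 : ‖D - 1‖ ≤ 4 * p ^ 2 := by
    refine (Complex.norm_le_abs_re_add_abs_im _).trans ?_
    rw [hD]
    simp only [Complex.sub_re, Complex.one_re, Complex.sub_im, Complex.one_im, sub_zero]
    have h1 : |b1 ^ 2 + t ^ 2 - e ^ 2 - 1| ≤ 2 * p ^ 2 := by
      rw [abs_le]; constructor <;> nlinarith only [hte, hbb, hb2p, sq_nonneg t, sq_nonneg e]
    have h2 : |2 * t * e| ≤ 2 * p ^ 2 := by
      rw [abs_le]; constructor <;> nlinarith only [hte, hb2p, sq_nonneg p, sq_nonneg (t + e), sq_nonneg (t - e)]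
    linarith
  obtain ⟨w, hw, hw0⟩ : ∃ w : ℂ, w ^ 2 = c / D ∧ 0 ≤ w.re := by
    obtain ⟨w, hw⟩ := IsAlgClosed.exists_pow_nat_eq ((c : ℂ) / D) (n := 2) (by norm_num)
    rcases le_total 0 w.re with h | h
    · exact ⟨w, hw, h⟩
    · exact ⟨-w, by rw [neg_sq, hw], by simpa using h⟩
  have hwn : ‖w‖ ^ 2 = 1 := by
    rw [← norm_pow, hw, norm_div, hDn, Complex.norm_real, Real.norm_eq_abs, abs_of_nonneg hc0]
    exact div_self (by linarith)
  have hww : w.re ^ 2 + w.im ^ 2 = 1 := by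
    rw [Complex.sq_norm, Complex.normSq_apply] at hwn; linarith
  have hw1 : ‖w - 1‖ ≤ 10 * p ^ 2 := by
    have h1 : 1 ≤ ‖w + 1‖ := by
      refine le_trans ?_ (Complex.abs_re_le_norm _)
      refine le_trans ?_ (le_abs_self _)
      simpa using hw0
    have h2 : ‖w - 1‖ * ‖w + 1‖ = ‖(c : ℂ) - D‖ / c := by
      rw [← norm_mul, ← hDn, ← norm_div]
      congr 1
      have : (w - 1) * (w + 1) = w ^ 2 - 1 := by ring
      rw [this, hw]; rw [hDn]; field_simp
    have h3 : ‖(c : ℂ) - D‖ ≤ 5 * p ^ 2 := by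
      have : (c : ℂ) - D = ((c - 1 : ℝ) : ℂ) - (D - 1) := by push_cast; ring
      rw [this]
      refine (norm_sub_le _ _).trans ?_
      rw [Complex.norm_real, Real.norm_eq_abs]
      have := (one_sub_le hc0 hc).1
      linarith
    have h4 : ‖(c : ℂ) - D‖ / c ≤ 10 * p ^ 2 := by
      rw [div_le_iff₀ (by linarith)]; nlinarith only [sq_nonneg p, h3, hc2]
    nlinarith only [norm_nonneg (w - 1), h1, h2, h4]
  refine ⟨a1, b1, b2, w.re, w.im, ha0, ha, hb0, hbb, hb2q, hww, ?_, ?_, ?_⟩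
  · have h1 := Complex.abs_re_le_norm (w - 1)
    have h2 := Complex.abs_im_le_norm (w - 1)
    simp only [Complex.sub_re, Complex.one_re, Complex.sub_im, Complex.one_im, sub_zero] at h1 h2
    nlinarith only [h1, h2, hw1, hp, hp4]
  · rw [← he, hes]
  · rw [← he, ← ht, ← hD, Complex.eta, hw]; field_simp

noncomputable def sg : Fin 4 → Matrix (Fin 2) (Fin 2) ℂ :=
  ![1, !![0, 1; 1, 0], !![0, -Complex.I; Complex.I, 0], !![1, 0; 0, -1]]

lemma sg_HI (k : Fin 4) : HI (sg k) := by
  fin_cases k <;> constructor <;> ext a b <;> fin_cases a <;> fin_cases b <;>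
    simp [sg, Matrix.mul_apply, Matrix.conjTranspose_apply]

lemma sg_split (k : Fin 4) (hk : k ≠ 0) : ∃ a b : Fin 4, a ≠ 0 ∧ b ≠ 0 ∧
    sg a * sg b = Complex.I • sg k ∧ sg b * sg a = (-1 : ℂ) • (sg a * sg b) := by
  have key : ∃ a b : Fin 4, a ≠ 0 ∧ b ≠ 0 ∧
    sg a * sg b = Complex.I • sg k ∧ sg b * sg a = (-Complex.I) • sg k := by
    fin_cases k
    · exact absurd rfl hk
    · refine ⟨2, 3, by decide, by decide, ?_, ?_⟩ <;> ext a b <;> fin_cases a <;> fin_cases b <;> simp [sg, Matrix.mul_apply]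
    · refine ⟨3, 1, by decide, by decide, ?_, ?_⟩ <;> ext a b <;> fin_cases a <;> fin_cases b <;> simp [sg, Matrix.mul_apply]
    · refine ⟨1, 2, by decide, by decide, ?_, ?_⟩ <;> ext a b <;> fin_cases a <;> fin_cases b <;> simp [sg, Matrix.mul_apply]
  obtain ⟨a, b, h1, h2, h3, h4⟩ := key
  exact ⟨a, b, h1, h2, h3, by rw [h3, h4, smul_smul]; simp⟩

lemma sg_sum (a b c d : Fin 2) : ∑ k, sg k a b * sg k c d = if a = d ∧ b = c then 2 else 0 := by
  fin_cases a <;> fin_cases b <;> fin_cases c <;> fin_cases d <;>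
    simp [sg, Fin.sum_univ_four] <;> norm_num

noncomputable def pau {n : ℕ} (l : Fin n → Fin 4) : QM n := tens (fun k => sg (l k))

lemma pau_HI {n : ℕ} (l : Fin n → Fin 4) : HI (pau l) := HI.tens (fun k => sg_HI (l k))

lemma synth {n : ℕ} {p : ℝ} (hp : 0 < p) (hp4 : p ≤ 1 / 4) (i : Fin n) (T : Finset (Fin n)) :
    i ∉ T → ∀ l : Fin n → Fin 4, l i ≠ 0 → (∀ k, k ≠ i → k ∉ T → l k = 0) →
      ∀ c s : ℝ, 0 ≤ c → c ^ 2 + s ^ 2 = 1 → |s| ≤ p ^ (T.card + 1) →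
        Reach (12 * p) (7 * 2 ^ T.card - 6) (gate (pau l) c s) := by
  induction T using Finset.induction_on with
  | empty =>
    intro _ l hl h c s hc0 hc hs
    simp only [Finset.card_empty, pow_zero, zero_add, pow_one] at hs ⊢
    apply Reach.single
    · refine local_one (fun k => sg_HI _) (i := i) (fun k hk => ?_) hc
      rw [h k hk (by simp)]; rfl
    · have := gate_sub_one' (pau_HI l) hc0 hc
      linarith
  | insert j T hj ih =>
    intro hi l hl h c s hc0 hc hs
    rw [Finset.card_insert_of_notMem hj] at hs ⊢
    have hij : i ≠ j := fun h => hi (by simp [h])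
    have hiT : i ∉ T := fun h => hi (by simp [h])
    obtain ⟨a1, b1, b2, w1, w2, ha0, ha, hb0, hb, hbq, hw, hw12, h1, h2⟩ :=
      step_scalar hp hp4 (q := p ^ (T.card + 1)) (by positivity)
        (by rw [pow_succ]; exact mul_le_of_le_one_left hp.le (pow_le_one₀ hp.le (by linarith))) hc0 hc
        (by rw [← pow_succ']; exact hs)
    obtain ⟨α, β, hα, hβ, hαβ, hβα⟩ := sg_split (l i) hl
    set lQ : Fin n → Fin 4 := Function.update (Function.update l j 0) i α with hlQ
    set lR : Fin n → Fin 4 := fun k => if k = i then β else if k = j then l j else 0 with hlR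
    have Qi : lQ i = α := by simp [hlQ]
    have Qj : lQ j = 0 := by simp [hlQ, Ne.symm hij]
    have Qk : ∀ k, k ≠ i → k ≠ j → lQ k = l k := by intro k h1 h2; simp [hlQ, h1, h2]
    have Ri : lR i = β := by simp [hlR]
    have Rj : lR j = l j := by simp [hlR, Ne.symm hij]
    have Rk : ∀ k, k ≠ i → k ≠ j → lR k = 0 := by intro k h1 h2; simp [hlR, h1, h2]
    have s0 : sg 0 = 1 := rfl
    have hX := (pau_HI lR).2
    have hY := (pau_HI lQ).2
    have hZ : pau lQ * pau lR = Complex.I • pau l := by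
      unfold pau
      rw [tens_mul]
      apply tens_smul _ _ i
      · rw [Qi, Ri, hαβ]
      · intro k hk
        by_cases hkj : k = j
        · subst hkj; rw [Qj, Rj, s0, one_mul]
        · rw [Qk k hk hkj, Rk k hk hkj, s0, mul_one]
    have hXY : pau lR * pau lQ = -(pau lQ * pau lR) := by
      unfold pau
      rw [tens_mul, tens_mul, ← neg_one_smul ℂ]
      apply tens_smul _ _ i
      · rw [Qi, Ri, hβα]
      · intro k hk
        by_cases hkj : k = j
        · subst hkj; rw [Qj, Rj, s0, one_mul, mul_one]
        · rw [Qk k hk hkj, Rk k hk hkj, s0, mul_one, one_mul]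
    have hloc : ∀ c s : ℝ, c ^ 2 + s ^ 2 = 1 → |c - 1| + |s| ≤ 12 * p →
        Reach (12 * p) 1 (gate (pau lR) c s) := by
      intro c s h1 h2
      apply Reach.single
      · refine local_two (fun k => sg_HI _) hij (fun k hk hk' => ?_) h1
        rw [Rk k hk hk']; rfl
      · exact (gate_sub_one (pau_HI lR) c s).trans h2
    have hap : |a1 - 1| + |p| ≤ 12 * p := by
      have := one_sub_le ha0 ha
      rw [abs_of_pos hp] at *
      linarith
    have hQ : ∀ s : ℝ, b1 ^ 2 + s ^ 2 = 1 → |s| ≤ p ^ (T.card + 1) →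
        Reach (12 * p) (7 * 2 ^ T.card - 6) (gate (pau lQ) b1 s) := by
      intro s h1 h2
      refine ih hiT lQ (by rw [Qi]; exact hα) ?_ b1 s hb0 h1 h2
      intro k hk hkT
      by_cases hkj : k = j
      · rw [hkj, Qj]
      · rw [Qk k hk hkj, h k hk (by simp [hkj, hkT])]
    have e1 := alg1 hX hY hXY hZ a1 p b1 b2 ha
    have e2 := alg1 hX hY hXY hZ a1 (-p) b1 (-b2) (by rw [neg_sq, ha])
    rw [neg_neg] at e2
    have e3 := alg2 hX hY hXY hZ (b1 : ℂ) ((b2 * (a1 ^ 2 - p ^ 2) : ℝ) : ℂ) ((b2 * (2 * a1 * p) : ℝ) : ℂ)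
    have e4 := alg3 hX hXY hZ w1 w2 hw _ _ s c h2
    have e5 : gate (pau l) c s = gate (pau lR) w1 w2 * ((gate (pau lR) a1 p * gate (pau lQ) b1 b2 * gate (pau lR) a1 (-p)) *
        (gate (pau lR) a1 (-p) * gate (pau lQ) b1 (-b2) * gate (pau lR) a1 p)) * gate (pau lR) w1 w2 := by
      rw [← e4, e1, e2]
      congr 2
      have h1' : (s : ℂ) = 2 * b1 * (b2 * (2 * a1 * p)) := by rw [← h1]; push_cast; ring
      rw [h1']
      push_cast at e3 ⊢
      rw [← e3]
      congr 1
      · congr 2; ring_nf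
      · module
    rw [e5]
    have hnp : a1 ^ 2 + (-p) ^ 2 = 1 := by rw [neg_sq, ha]
    have hap' : |a1 - 1| + |-p| ≤ 12 * p := by rwa [abs_neg]
    refine Reach.mono (Reach.mul (Reach.mul (hloc w1 w2 hw hw12) (Reach.mul
      (Reach.mul (Reach.mul (hloc _ _ ha hap) (hQ b2 hb hbq)) (hloc _ _ hnp hap'))
      (Reach.mul (Reach.mul (hloc _ _ hnp hap') (hQ (-b2) (by rw [neg_sq, hb]) (by rwa [abs_neg]))) (hloc _ _ ha hap))))
      (hloc w1 w2 hw hw12)) ?_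
    have : 1 ≤ 2 ^ T.card := Nat.one_le_two_pow
    rw [pow_succ]
    omega

lemma synth_all {n : ℕ} (hn : 1 ≤ n) {p : ℝ} (hp : 0 < p) (hp4 : p ≤ 1 / 4) (l : Fin n → Fin 4)
    (c s : ℝ) (hc0 : 0 ≤ c) (hc : c ^ 2 + s ^ 2 = 1) (hs : |s| ≤ p ^ n) :
    Reach (12 * p) (7 * 2 ^ n) (gate (pau l) c s) := by
  by_cases h : ∃ i, l i ≠ 0
  · obtain ⟨i, hi⟩ := h
    have hcard : (Finset.univ.erase i).card + 1 = n := by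
      rw [Finset.card_erase_add_one (Finset.mem_univ i)]; simp
    refine (synth hp hp4 i (Finset.univ.erase i) (by simp) l hi ?_ c s hc0 hc ?_).mono ?_
    · intro k hk hk'; simp [hk] at hk'
    · rw [hcard]; exact hs
    · have : 2 ^ (Finset.univ.erase i).card ≤ 2 ^ n := Nat.pow_le_pow_right (by norm_num) (by omega)
      omega
  · push Not at h
    refine (Reach.single (κ := 12 * p) ?_ ?_).mono ?_
    · refine local_one (fun k => sg_HI _) (i := ⟨0, hn⟩) (fun k hk => ?_) hc
      rw [h k]; rfl
    · have h1 := gate_sub_one' (pau_HI l) hc0 hc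
      have : p ^ n ≤ p := by
        calc p ^ n ≤ p ^ 1 := pow_le_pow_of_le_one hp.le (by linarith) hn
          _ = p := pow_one p
      linarith
    · have : 1 ≤ 2 ^ n := Nat.one_le_two_pow
      omega

lemma enorm_eq {I : Type*} [Fintype I] (u : I → ℂ) : _root_.enorm u = ‖WithLp.toLp 2 u‖ := by
  rw [EuclideanSpace.norm_eq]; rfl

lemma enorm_mulVec {I : Type*} [Fintype I] [DecidableEq I] (M : Matrix I I ℂ) (u : I → ℂ) :
    _root_.enorm (M.mulVec u) ≤ ‖M‖ * _root_.enorm u := by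
  rw [enorm_eq, enorm_eq]
  exact Matrix.l2_opNorm_mulVec M (WithLp.toLp 2 u)

lemma enorm_add {I : Type*} [Fintype I] (u v : I → ℂ) : _root_.enorm (u + v) ≤ _root_.enorm u + _root_.enorm v := by
  rw [enorm_eq, enorm_eq, enorm_eq, WithLp.toLp_add]; exact norm_add_le _ _

lemma enorm_sub {I : Type*} [Fintype I] (u v : I → ℂ) : _root_.enorm (u - v) ≤ _root_.enorm u + _root_.enorm v := by
  rw [enorm_eq, enorm_eq, enorm_eq, WithLp.toLp_sub]; exact norm_sub_le _ _

lemma enorm_comm {I : Type*} [Fintype I] (u v : I → ℂ) : _root_.enorm (u - v) = _root_.enorm (v - u) := by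
  rw [enorm_eq, enorm_eq, WithLp.toLp_sub, WithLp.toLp_sub]; exact norm_sub_rev _ _

lemma enorm_smul' {I : Type*} [Fintype I] (c : ℂ) (u : I → ℂ) : _root_.enorm (c • u) = ‖c‖ * _root_.enorm u := by
  rw [enorm_eq, enorm_eq, WithLp.toLp_smul, norm_smul]

lemma cs {I : Type*} [Fintype I] (u v : I → ℂ) : ‖star u ⬝ᵥ v‖ ≤ _root_.enorm u * _root_.enorm v := by
  rw [enorm_eq, enorm_eq]
  have := norm_inner_le_norm (𝕜 := ℂ) (WithLp.toLp 2 u) (WithLp.toLp 2 v)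
  rwa [EuclideanSpace.inner_toLp_toLp, dotProduct_comm] at this

lemma enorm_sq {I : Type*} [Fintype I] (u : I → ℂ) : star u ⬝ᵥ u = ((_root_.enorm u ^ 2 : ℝ) : ℂ) := by
  unfold _root_.enorm
  rw [Real.sq_sqrt (by positivity)]
  simp only [dotProduct, Pi.star_apply, RCLike.star_def]
  push_cast
  refine Finset.sum_congr rfl fun i _ => ?_
  rw [mul_comm, Complex.mul_conj']

lemma pau_complete {n : ℕ} (x y x' y' : Fin n → Fin 2) :
    ∑ l : Fin n → Fin 4, pau l x y * pau l x' y' = if x = y' ∧ y = x' then (2 : ℂ) ^ n else 0 := by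
  have : ∀ l : Fin n → Fin 4, pau l x y * pau l x' y' = ∏ k, (sg (l k) (x k) (y k) * sg (l k) (x' k) (y' k)) := by
    intro l; simp only [pau, tens, Finset.prod_mul_distrib]
  simp only [this]
  have h2 := Finset.prod_univ_sum (fun _ : Fin n => (Finset.univ : Finset (Fin 4)))
    (fun k a => sg a (x k) (y k) * sg a (x' k) (y' k))
  rw [Fintype.piFinset_univ] at h2
  rw [← h2]
  simp only [sg_sum]
  rw [Finset.prod_ite_zero]
  simp [funext_iff, forall_and]

lemma pau_expand {n : ℕ} (K : QM n) : ∑ l : Fin n → Fin 4, (pau l * K).trace • pau l = ((2 : ℂ) ^ n) • K := by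
  ext x y
  simp only [Matrix.sum_apply, Matrix.smul_apply, smul_eq_mul, Matrix.trace, Matrix.diag_apply, Matrix.mul_apply,
    Finset.sum_mul]
  rw [Finset.sum_comm]
  have : ∀ x' : Fin n → Fin 2, ∑ l : Fin n → Fin 4, ∑ y' : Fin n → Fin 2, pau l x' y' * K y' x' * pau l x y
      = ∑ y' : Fin n → Fin 2, K y' x' * (if x = y' ∧ y = x' then (2 : ℂ) ^ n else 0) := by
    intro x'
    rw [Finset.sum_comm]
    refine Finset.sum_congr rfl fun y' _ => ?_
    rw [← pau_complete, Finset.mul_sum]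
    refine Finset.sum_congr rfl fun l _ => ?_
    ring
  simp only [this, ite_and, mul_ite, mul_zero, Finset.sum_ite_eq, Finset.mem_univ, if_true]
  ring

lemma trotter {n : ℕ} (h : (Fin n → Fin 4) → ℝ) (hh : ∀ l, h l ^ 2 ≤ 1) (L : List (Fin n → Fin 4)) :
    ‖(L.map (fun l => gate (pau l) (√(1 - h l ^ 2)) (h l))).prod‖ ≤ 1 ∧
    ‖(L.map (fun l => gate (pau l) (√(1 - h l ^ 2)) (h l))).prod - 1‖ ≤ 2 * (L.map (fun l => |h l|)).sum ∧
    ‖(L.map (fun l => gate (pau l) (√(1 - h l ^ 2)) (h l))).prod - 1 -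
      (L.map (fun l => (Complex.I * h l) • pau l)).sum‖ ≤ (L.map (fun l => |h l|)).sum ^ 2 := by
  induction L with
  | nil => simp [(HI.one (I := Fin n → Fin 2)).norm_le]
  | cons l L ih =>
    simp only [List.map_cons, List.prod_cons, List.sum_cons]
    set W := (L.map (fun l => gate (pau l) (√(1 - h l ^ 2)) (h l))).prod
    set S := (L.map (fun l => |h l|)).sum
    set A := (L.map (fun l => (Complex.I * h l) • pau l)).sum
    obtain ⟨i1, i2, i3⟩ := ih
    have hc0 : 0 ≤ √(1 - h l ^ 2) := Real.sqrt_nonneg _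
    have hc : √(1 - h l ^ 2) ^ 2 + h l ^ 2 = 1 := by
      rw [Real.sq_sqrt (by linarith [hh l])]; ring
    set G := gate (pau l) (√(1 - h l ^ 2)) (h l)
    have g0 : ‖G‖ ≤ 1 := norm_le_of_unit (gate_unit (pau_HI l) hc).1 (gate_unit (pau_HI l) hc).2
    have g1 : ‖G - 1‖ ≤ 2 * |h l| := gate_sub_one' (pau_HI l) hc0 hc
    have g2 : ‖G - 1 - (Complex.I * h l) • pau l‖ ≤ h l ^ 2 := gate_first (pau l) hc0 hc
    refine ⟨?_, ?_, ?_⟩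
    · exact (norm_mul_le _ _).trans (mul_le_one₀ g0 (norm_nonneg _) i1)
    · have : G * W - 1 = (G - 1) * W + (W - 1) := by noncomm_ring
      rw [this]
      refine (norm_add_le _ _).trans ?_
      have : ‖(G - 1) * W‖ ≤ 2 * |h l| :=
        (norm_mul_le _ _).trans ((mul_le_of_le_one_right (norm_nonneg _) i1).trans g1)
      linarith
    · have : G * W - 1 - ((Complex.I * h l) • pau l + A) = (G - 1 - (Complex.I * h l) • pau l) * W
          + ((Complex.I * h l) • pau l) * (W - 1) + (W - 1 - A) := by noncomm_ring
      rw [this]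
      refine (norm_add₃_le).trans ?_
      have j1 : ‖(G - 1 - (Complex.I * h l) • pau l) * W‖ ≤ h l ^ 2 :=
        (norm_mul_le _ _).trans ((mul_le_of_le_one_right (norm_nonneg _) i1).trans g2)
      have j2 : ‖((Complex.I * h l) • pau l) * (W - 1)‖ ≤ |h l| * (2 * S) := by
        refine (norm_mul_le _ _).trans ?_
        have : ‖(Complex.I * h l) • pau l‖ ≤ |h l| := by
          rw [norm_smul]
          simp only [Complex.norm_real, norm_mul, Complex.norm_I, one_mul, Real.norm_eq_abs]
          exact mul_le_of_le_one_right (abs_nonneg _) (pau_HI l).norm_le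
        gcongr
      rw [add_sq, sq_abs]
      linarith

lemma Reach.list {n : ℕ} {κ : ℝ} {N : ℕ} {β : Type*} (F : β → QM n) (h : ∀ b, Reach κ N (F b)) (L : List β) :
    Reach κ (L.length * N) (L.map F).prod := by
  induction L with
  | nil => exact ⟨[], by simp, by simp, by simp⟩
  | cons b L ih =>
    rw [List.map_cons, List.prod_cons]
    exact ((h b).mul ih).mono (by rw [List.length_cons]; nlinarith)

lemma seq_getD {I : Type*} [Fintype I] [DecidableEq I] (ψ : I → ℂ) (L : List (Matrix I I ℂ)) :
    ∀ k ≤ L.length, seqApply (fun i => L.getD i 1) ψ k = ((L.take k).reverse.prod).mulVec ψ := by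
  intro k
  induction k with
  | zero => intro _; simp [seqApply]
  | succ k ih =>
    intro hk
    have hk' : k < L.length := hk
    rw [seqApply, ih hk'.le, List.take_succ_eq_append_getElem hk', List.reverse_append, List.prod_append,
      ← Matrix.mulVec_mulVec]
    simp [hk']

lemma seq_disp {n : ℕ} {κ : ℝ} (ψ : (Fin n → Fin 2) → ℂ) (hψ : _root_.enorm ψ = 1) (U : ℕ → QM n) (m : ℕ)
    (hU : ∀ i, i < m → IsTwoLocalUnitary (U i) ∧ ‖U i - 1‖ ≤ κ) :
    ∀ k ≤ m, _root_.enorm (seqApply U ψ k) ≤ 1 ∧ _root_.enorm (ψ - seqApply U ψ k) ≤ k * κ := by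
  intro k
  induction k with
  | zero => intro _; simp [seqApply, hψ]; simp [_root_.enorm]
  | succ k ih =>
    intro hk
    obtain ⟨i1, i2⟩ := ih (by omega)
    obtain ⟨u1, u2⟩ := hU k hk
    have hn : ‖U k‖ ≤ 1 := norm_le_of_unit u1.1 u1.2.1
    have h0 : 0 ≤ _root_.enorm (seqApply U ψ k) := Real.sqrt_nonneg _
    constructor
    · exact (enorm_mulVec _ _).trans (mul_le_one₀ hn h0 i1)
    · have : ψ - seqApply U ψ (k + 1) = (ψ - seqApply U ψ k) - (U k - 1).mulVec (seqApply U ψ k) := by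
        rw [seqApply, Matrix.sub_mulVec, Matrix.one_mulVec]; abel
      rw [this]
      refine (enorm_sub _ _).trans ?_
      have : _root_.enorm ((U k - 1).mulVec (seqApply U ψ k)) ≤ κ :=
        (enorm_mulVec _ _).trans ((mul_le_of_le_one_right (norm_nonneg _) i1).trans u2)
      push_cast
      linarith

set_option maxHeartbeats 1000000 in
lemma generator {n : ℕ} (ψ φ : (Fin n → Fin 2) → ℂ) (ε : ℝ) (hψ : _root_.enorm ψ = 1) (hφ : _root_.enorm φ = 1)
    (hε : _root_.enorm (ψ - φ) ≤ ε) :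
    ∃ h : (Fin n → Fin 4) → ℝ, (∀ l, |h l| ≤ 3 * ε / 2 ^ n) ∧
      _root_.enorm (φ - ψ - (∑ l, (Complex.I * h l) • pau l).mulVec ψ) ≤ ε ^ 2 := by
  set η := φ - ψ with hη
  have hηε : _root_.enorm η ≤ ε := by rw [hη, enorm_comm]; exact hε
  have hη0 : 0 ≤ _root_.enorm η := Real.sqrt_nonneg _
  set z : ℂ := star η ⬝ᵥ ψ with hz
  have hzε : ‖z‖ ≤ ε := by
    refine (cs _ _).trans ?_
    rw [hψ, mul_one]; exact hηε
  have hzre : z.re = - (_root_.enorm η ^ 2) / 2 := by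
    have h1 : star φ ⬝ᵥ φ = star η ⬝ᵥ η + z + star z + star ψ ⬝ᵥ ψ := by
      have : φ = η + ψ := by rw [hη]; abel
      have h2 : star z = star ψ ⬝ᵥ η := by rw [hz, ← Matrix.star_dotProduct]
      rw [h2, hz, this, star_add, add_dotProduct, dotProduct_add, dotProduct_add]; ring
    rw [enorm_sq, enorm_sq, enorm_sq, hψ, hφ] at h1
    have := congrArg Complex.re h1
    simp [-Complex.ofReal_pow] at this
    linarith
  set K : QM n := Matrix.vecMulVec η (star ψ) - Matrix.vecMulVec ψ (star η) +
    (Complex.I * z.im) • Matrix.vecMulVec ψ (star ψ) with hK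
  have hKH : Kᴴ = -K := by
    rw [hK]
    simp only [Matrix.conjTranspose_add, Matrix.conjTranspose_sub, Matrix.conjTranspose_smul,
      Matrix.conjTranspose_vecMulVec, star_star]
    simp
    abel
  have hKψ : K.mulVec ψ = η - (z.re : ℂ) • ψ := by
    rw [hK, Matrix.add_mulVec, Matrix.sub_mulVec, Matrix.smul_mulVec]
    simp only [Matrix.vecMulVec_mulVec, enorm_sq, hψ]
    rw [← hz]
    ext x
    simp
    linear_combination (ψ x) * (Complex.re_add_im z)
  have htr : ∀ l, (pau l * K).trace = Complex.I * ((pau l * K).trace.im : ℝ) := by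
    intro l
    have h1 : star (pau l * K).trace = - (pau l * K).trace := by
      rw [← Matrix.trace_conjTranspose, Matrix.conjTranspose_mul, hKH, (pau_HI l).1, neg_mul, Matrix.trace_neg,
        Matrix.trace_mul_comm]
    have h2 := congrArg Complex.re h1
    simp at h2
    apply Complex.ext
    · simp; linarith
    · simp
  have hbd : ∀ l, ‖(pau l * K).trace‖ ≤ 3 * ε := by
    intro l
    have key : ∀ a b : (Fin n → Fin 2) → ℂ, ‖(pau l * Matrix.vecMulVec a (star b)).trace‖ ≤ _root_.enorm a * _root_.enorm b := by
      intro a b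
      rw [Matrix.mul_vecMulVec, Matrix.trace_vecMulVec, dotProduct_comm]
      refine (cs _ _).trans ?_
      have := enorm_mulVec (pau l) a
      have h3 := (pau_HI l).norm_le
      have h4 : 0 ≤ _root_.enorm a := Real.sqrt_nonneg _
      have h5 : 0 ≤ _root_.enorm b := Real.sqrt_nonneg _
      rw [mul_comm]
      gcongr
      exact this.trans (mul_le_of_le_one_left h4 h3)
    rw [hK, mul_add, mul_sub, Matrix.trace_add, Matrix.trace_sub, mul_smul_comm, Matrix.trace_smul]
    have k1 := key η ψ
    have k2 := key ψ η
    have k3 := key ψ ψ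
    rw [hψ] at k1 k2 k3
    have k4 : ‖(Complex.I * z.im) • (pau l * Matrix.vecMulVec ψ (star ψ)).trace‖ ≤ ε := by
      rw [norm_smul, norm_mul, Complex.norm_I, one_mul, Complex.norm_real, Real.norm_eq_abs]
      calc _ ≤ |z.im| * 1 := by gcongr; linarith
        _ ≤ ε := by rw [mul_one]; exact (Complex.abs_im_le_norm z).trans hzε
    refine (norm_add_le _ _).trans ?_
    have := norm_sub_le (pau l * Matrix.vecMulVec η (star ψ)).trace (pau l * Matrix.vecMulVec ψ (star η)).trace
    linarith
  refine ⟨fun l => (pau l * K).trace.im / 2 ^ n, ?_, ?_⟩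
  · intro l
    rw [abs_div, abs_of_pos (by positivity : (0 : ℝ) < 2 ^ n)]
    gcongr
    exact (Complex.abs_im_le_norm _).trans (hbd l)
  · have : ∑ l, (Complex.I * (((pau l * K).trace.im / 2 ^ n : ℝ) : ℂ)) • pau l = K := by
      have h1 := pau_expand K
      have h2 : ((2 : ℂ) ^ n)⁻¹ • (∑ l : Fin n → Fin 4, (pau l * K).trace • pau l) = K := by
        rw [h1, smul_smul, inv_mul_cancel₀ (by positivity), one_smul]
      refine Eq.trans ?_ h2
      rw [Finset.smul_sum]
      refine Finset.sum_congr rfl fun l _ => ?_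
      rw [smul_smul]
      congr 1
      conv_rhs => rw [htr l]
      push_cast
      field_simp
    rw [this, hKψ]
    have : η - (η - (z.re : ℂ) • ψ) = (z.re : ℂ) • ψ := by abel
    rw [this, enorm_smul', hψ, hzre, Complex.norm_real, Real.norm_eq_abs, mul_one, abs_div, abs_neg, abs_of_nonneg (by positivity)]
    have : _root_.enorm η ^ 2 ≤ ε ^ 2 := pow_le_pow_left₀ hη0 hηε 2
    rw [abs_of_pos (by norm_num)]
    nlinarith [sq_nonneg ε]

/-- **Mapping between close vectors via 2-local gates** (Lemma `lem:map-close-vectors`). -/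
theorem map_close_vectors :
    ∃ C : ℝ, 0 < C ∧
      ∀ (n : ℕ), 1 ≤ n →
        ∀ (ψ φ : (Fin n → Fin 2) → ℂ) (ε : ℝ),
          _root_.enorm ψ = 1 → _root_.enorm φ = 1 →
          _root_.enorm (ψ - φ) ≤ ε → ε < (Real.pi / 16) ^ (2 * n) →
            ∃ (m : ℕ) (U : ℕ → Matrix (Fin n → Fin 2) (Fin n → Fin 2) ℂ),
              (m : ℝ) ≤ (2 : ℝ) ^ (C * (n : ℝ)) ∧
              (∀ i, i < m → IsTwoLocalUnitary (U i)) ∧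
              _root_.enorm (φ - seqApply U ψ m) ≤ C * ((2 : ℝ) ^ n) ^ 2 * ε ^ 2 ∧
              ∀ i, 1 ≤ i → i ≤ m →
                _root_.enorm (ψ - seqApply U ψ i) ≤
                  C * (n : ℝ) ^ 2 * ((2 : ℝ) ^ n) ^ 2 * ε ^ ((1 : ℝ) / (2 * n)) := by
  refine ⟨200, by norm_num, ?_⟩
  intro n hn ψ φ ε hψ hφ hε hεn
  have hε0 : 0 ≤ ε := le_trans (Real.sqrt_nonneg _) hε
  rcases hε0.eq_or_lt with h0 | hpos
  · refine ⟨0, fun _ => 1, by simp; positivity, by simp, ?_, ?_⟩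
    · rw [seqApply, enorm_comm]
      exact hε.trans (by rw [← h0]; simp)
    · intro i h1 h2; omega
  obtain ⟨δ, hδ⟩ : ∃ δ, δ = ε ^ ((1 : ℝ) / (2 * n)) := ⟨_, rfl⟩
  have hn0 : (0 : ℝ) < n := by exact_mod_cast hn
  have hδ0 : 0 < δ := by rw [hδ]; positivity
  have hδε : δ ^ (2 * n) = ε := by
    rw [hδ, ← Real.rpow_natCast, ← Real.rpow_mul hε0]
    push_cast
    rw [one_div, inv_mul_cancel₀ (by positivity), Real.rpow_one]
  have hδ4 : δ < 1 / 4 := by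
    have : δ < Real.pi / 16 := by
      apply lt_of_pow_lt_pow_left₀ (2 * n) (by positivity)
      rw [hδε]; exact hεn
    linarith [Real.pi_lt_four]
  obtain ⟨p, hp⟩ : ∃ p, p = 2 * δ ^ 2 := ⟨_, rfl⟩
  have hp0 : 0 < p := by rw [hp]; positivity
  have hp4 : p ≤ 1 / 4 := by rw [hp]; nlinarith
  obtain ⟨h, hh, herr⟩ := generator ψ φ ε hψ hφ hε
  have hd0 : (0 : ℝ) < 2 ^ n := by positivity
  have hd2 : (2 : ℝ) ≤ 2 ^ n := by
    calc (2 : ℝ) = 2 ^ 1 := by norm_num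
      _ ≤ 2 ^ n := pow_le_pow_right₀ (by norm_num) hn
  have hhp : ∀ l, |h l| ≤ p ^ n := by
    intro l
    refine (hh l).trans ?_
    rw [hp, mul_pow, ← pow_mul, hδε, div_le_iff₀ hd0]
    nlinarith only [mul_le_mul hd2 hd2 (by norm_num) hd0.le, hpos]
  have hh1 : ∀ l, h l ^ 2 ≤ 1 := by
    intro l
    rw [← sq_abs]
    exact pow_le_one₀ (abs_nonneg _) ((hhp l).trans (pow_le_one₀ hp0.le (by linarith)))
  obtain ⟨P, hP⟩ : ∃ P : List (Fin n → Fin 4), P = Finset.univ.toList := ⟨_, rfl⟩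
  have hPlen : P.length = 4 ^ n := by rw [hP]; simp
  obtain ⟨t1, -, t3⟩ := trotter h hh1 P
  have hreach := Reach.list (κ := 12 * p) (N := 7 * 2 ^ n)
    (fun l => gate (pau l) (√(1 - h l ^ 2)) (h l))
    (fun l => synth_all hn hp0 hp4 l _ _ (Real.sqrt_nonneg _)
      (by rw [Real.sq_sqrt (by linarith [hh1 l])]; ring) (hhp l)) P
  obtain ⟨L, hL1, hL2, hL3⟩ := hreach
  set W := (P.map (fun l => gate (pau l) (√(1 - h l ^ 2)) (h l))).prod
  have hsum : (P.map (fun l => (Complex.I * h l) • pau l)).sum = ∑ l, (Complex.I * h l) • pau l := by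
    rw [hP, Finset.sum_map_toList]
  have hS : (P.map (fun l => |h l|)).sum ≤ 3 * 2 ^ n * ε := by
    rw [hP, Finset.sum_map_toList]
    refine (Finset.sum_le_sum (fun l _ => hh l)).trans ?_
    rw [Finset.sum_const, Finset.card_univ, nsmul_eq_mul]
    simp only [Fintype.card_fun, Fintype.card_fin]
    have : ((4 ^ n : ℕ) : ℝ) = 2 ^ n * 2 ^ n := by
      push_cast; rw [← mul_pow]; norm_num
    rw [this]
    apply le_of_eq
    field_simp
  have hS0 : 0 ≤ (P.map (fun l => |h l|)).sum := by
    rw [hP, Finset.sum_map_toList]; positivity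
  rw [hsum] at t3
  have hmem : ∀ i, i < L.reverse.length →
      IsTwoLocalUnitary (L.reverse.getD i 1) ∧ ‖L.reverse.getD i 1 - 1‖ ≤ 12 * p := by
    intro i hi
    apply hL2
    rw [List.getD_eq_getElem _ _ hi, ← List.mem_reverse]
    exact List.getElem_mem hi
  have hlen : (L.reverse.length : ℝ) ≤ 7 * (2 ^ n) ^ 3 := by
    rw [List.length_reverse]
    have : (L.length : ℝ) ≤ ((P.length * (7 * 2 ^ n) : ℕ) : ℝ) := by exact_mod_cast hL1
    refine this.trans (le_of_eq ?_)
    rw [hPlen]; push_cast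
    have : (4 : ℝ) ^ n = 2 ^ n * 2 ^ n := by rw [← mul_pow]; norm_num
    rw [this]; ring
  have hfin : seqApply (fun i => L.reverse.getD i 1) ψ L.reverse.length = W.mulVec ψ := by
    rw [seq_getD ψ L.reverse _ le_rfl, List.take_length, List.reverse_reverse, hL3]
  refine ⟨L.reverse.length, fun i => L.reverse.getD i 1, ?_, fun i hi => (hmem i hi).1, ?_, ?_⟩
  · refine hlen.trans ?_
    have e : (2 : ℝ) ^ ((200 : ℝ) * n) = ((2 : ℝ) ^ n) ^ 200 := by
      rw [← pow_mul, ← Real.rpow_natCast]; congr 1; push_cast; ring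
    rw [e]
    calc 7 * ((2 : ℝ) ^ n) ^ 3 ≤ ((2 : ℝ) ^ n) ^ 3 * ((2 : ℝ) ^ n) ^ 3 := by
          gcongr
          calc (7 : ℝ) ≤ 2 ^ 3 := by norm_num
            _ ≤ (2 ^ n) ^ 3 := by gcongr
      _ = ((2 : ℝ) ^ n) ^ 6 := by ring
      _ ≤ _ := pow_le_pow_right₀ (by linarith) (by norm_num)
  · rw [hfin]
    have e : φ - W.mulVec ψ = (φ - ψ - (∑ l, (Complex.I * h l) • pau l).mulVec ψ) -
        (W - 1 - ∑ l, (Complex.I * h l) • pau l).mulVec ψ := by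
      rw [Matrix.sub_mulVec, Matrix.sub_mulVec, Matrix.one_mulVec]; abel
    rw [e]
    refine (enorm_sub _ _).trans ?_
    have e2 := enorm_mulVec (W - 1 - ∑ l, (Complex.I * h l) • pau l) ψ
    rw [hψ, mul_one] at e2
    have e3 := pow_le_pow_left₀ hS0 hS 2
    have e4 : ε ^ 2 ≤ (2 ^ n) ^ 2 * ε ^ 2 := le_mul_of_one_le_left (by positivity) (one_le_pow₀ (by linarith))
    have e5 : (3 * 2 ^ n * ε) ^ 2 = 9 * ((2 ^ n) ^ 2 * ε ^ 2) := by ring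
    have e6 : 200 * ((2 : ℝ) ^ n) ^ 2 * ε ^ 2 = 200 * ((2 ^ n) ^ 2 * ε ^ 2) := by ring
    rw [e6]
    have : 0 ≤ ((2 : ℝ) ^ n) ^ 2 * ε ^ 2 := by positivity
    linarith
  · intro i _ hi
    rw [← hδ]
    obtain ⟨d1, d2⟩ := seq_disp ψ hψ (fun i => L.reverse.getD i 1) _ hmem i hi
    have hn1 : (1 : ℝ) ≤ (n : ℝ) ^ 2 := one_le_pow₀ (by exact_mod_cast hn)
    have key : _root_.enorm (ψ - seqApply (fun i => L.reverse.getD i 1) ψ i) ≤ 200 * ((2 ^ n) ^ 2 * δ) := by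
      rcases le_total (2 ^ n * δ) 1 with hc | hc
      · refine d2.trans ?_
        have hi' : (i : ℝ) ≤ 7 * (2 ^ n) ^ 3 := le_trans (by exact_mod_cast hi) hlen
        calc (i : ℝ) * (12 * p) ≤ (7 * (2 ^ n) ^ 3) * (12 * p) := by gcongr
          _ = 168 * ((2 ^ n) ^ 2 * δ) * (2 ^ n * δ) := by rw [hp]; ring
          _ ≤ 168 * ((2 ^ n) ^ 2 * δ) := mul_le_of_le_one_right (by positivity) hc
          _ ≤ _ := by gcongr; norm_num
      · refine (enorm_sub _ _).trans ?_
        rw [hψ]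
        have : 1 ≤ 2 ^ n * (2 ^ n * δ) := by nlinarith
        have e : (2 ^ n) ^ 2 * δ = 2 ^ n * (2 ^ n * δ) := by ring
        rw [e]; linarith
    refine key.trans ?_
    have : 200 * (n : ℝ) ^ 2 * (2 ^ n) ^ 2 * δ = (n : ℝ) ^ 2 * (200 * ((2 ^ n) ^ 2 * δ)) := by ring
    rw [this]
    exact le_mul_of_one_le_left (by positivity) hn1
end
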